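/- For every integer n ≥ 1, (1 − 1/12)·2π·n^{−13/2}·I_13(4π√n) < d(n) < (1 + 1/12)·2π·n^{−13/2}·I_13(4π√n). -/

import Mathlib

open Real

/-- The modified Bessel function of the first kind. -/
noncomputable def besselI (ν x : ℝ) : ℝ :=
  ∑' k : ℕ, (x / 2) ^ (2 * (k : ℝ) + ν) / ((k.factorial : ℝ) * Real.Gamma ((k : ℝ) + ν + 1))

/-- `d n` is the coefficient of `q^(n+1)` in `∏ (1 - q^j)^{-24}`, i.e. the number of
24-tuples of integer partitions whose sizes sum to `n+1` (and `0` for `n < -1`). -/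
def dcoef (n : ℤ) : ℤ :=
  if 0 ≤ n + 1 then
    ∑ v ∈ Finset.Nat.antidiagonalTuple 24 (n + 1).toNat,
      ∏ i, (Fintype.card (Nat.Partition (v i)) : ℤ)
  else 0

namespace PartitionSeries

open PowerSeries Finset

/-- The generating function of partitions. -/
noncomputable def partitionSeries (R : Type*) [Semiring R] : R⟦X⟧ :=
  PowerSeries.mk fun n ↦ (Fintype.card (Nat.Partition n) : R)

/-- The generating function of partitions into parts of size at most `N`. -/
noncomputable def boundedSeries (R : Type*) [Semiring R] (N : ℕ) : R⟦X⟧ :=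
  PowerSeries.mk fun n ↦ ((Nat.Partition.restricted n (· ≤ N)).card : R)

/-- The number of 24-tuples of partitions with total size `m`. -/
def multiCount (m : ℕ) : ℕ :=
  ∑ v ∈ Finset.Nat.antidiagonalTuple 24 m, ∏ i, Fintype.card (Nat.Partition (v i))

lemma dcoef_natCast (n : ℕ) : dcoef n = multiCount (n + 1) := by
  have h : (0 : ℤ) ≤ (n : ℤ) + 1 := by positivity
  rw [dcoef, if_pos h, multiCount]
  push_cast
  rfl

lemma coeff_partitionSeries_pow (R : Type*) [CommSemiring R] (m : ℕ) :
    coeff m (partitionSeries R ^ 24) = (multiCount m : R) := by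
  have h : partitionSeries R ^ 24 = ∏ _i : Fin 24, partitionSeries R := by simp
  rw [h, coeff_prod, multiCount]
  push_cast
  refine Finset.sum_equiv Finsupp.equivFunOnFinite (fun l ↦ ?_) (fun l _ ↦ ?_)
  · simp [Finset.Nat.mem_antidiagonalTuple]
  · simp [partitionSeries]

lemma multiCount_zero : multiCount 0 = 1 := by
  have := coeff_partitionSeries_pow ℕ 0
  rw [Nat.cast_id] at this
  rw [← this, coeff_zero_eq_constantCoeff, map_pow, ← coeff_zero_eq_constantCoeff_apply]
  simp [partitionSeries]

/-- The geometric series in `X ^ k`. -/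
noncomputable def geomSeries (R : Type*) [Semiring R] (k : ℕ) : R⟦X⟧ :=
  PowerSeries.mk fun n ↦ if k ∣ n then 1 else 0

lemma geomSeries_mul (R : Type*) [CommRing R] {k : ℕ} (hk : 0 < k) :
    geomSeries R k * (1 - X ^ k) = 1 := by
  ext n
  rw [mul_sub, mul_one, map_sub, coeff_mul_X_pow', coeff_one]
  simp only [geomSeries, coeff_mk]
  rcases Nat.eq_zero_or_pos n with rfl | hn
  · simp [hk.ne']
  · rw [if_neg hn.ne']
    by_cases h : k ≤ n
    · rw [if_pos h]
      rw [if_congr (Nat.dvd_sub_iff_left h dvd_rfl) rfl rfl, sub_self]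
    · rw [if_neg h, if_neg (fun hd ↦ h (Nat.le_of_dvd hn hd)), sub_zero]

open PowerSeries.WithPiTopology in
lemma boundedSeries_mul (R : Type*) [CommRing R] [TopologicalSpace R] [IsTopologicalRing R]
    [T2Space R] (N : ℕ) :
    boundedSeries R N * ∏ i ∈ range N, (1 - X ^ (i + 1)) = 1 := by
  have h := Nat.Partition.hasProd_powerSeriesMk_card_restricted R (· ≤ N)
  have h2 := hasProd_prod_of_ne_finset_one (L := .unconditional ℕ) (s := range N)
    (f := fun i ↦ if i + 1 ≤ N then ∑' j : ℕ, (X : R⟦X⟧) ^ ((i + 1) * j) else 1)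
    (fun i hi ↦ by simp at hi; simp; omega)
  rw [boundedSeries, HasProd.unique h h2, ← prod_mul_distrib]
  refine prod_eq_one fun i hi ↦ ?_
  rw [if_pos (by simpa using hi)]
  simp_rw [pow_mul]
  exact tsum_pow_mul_one_sub_of_constantCoeff_eq_zero (by simp)

lemma boundedSeries_eq_prod (R : Type*) [CommRing R] [TopologicalSpace R] [IsTopologicalRing R]
    [T2Space R] (N : ℕ) :
    boundedSeries R N = ∏ i ∈ range N, geomSeries R (i + 1) := by
  have h : (∏ i ∈ range N, geomSeries R (i + 1)) * ∏ i ∈ range N, (1 - X ^ (i + 1)) = 1 := by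
    rw [← prod_mul_distrib]
    exact prod_eq_one fun i _ ↦ geomSeries_mul R (Nat.succ_pos i)
  exact left_inv_eq_right_inv (boundedSeries_mul R N) ((mul_comm _ _).trans h)

lemma coeff_boundedSeries_of_le (R : Type*) [Semiring R] {m N : ℕ} (h : m ≤ N) :
    coeff m (boundedSeries R N) = coeff m (partitionSeries R) := by
  simp only [boundedSeries, partitionSeries, coeff_mk, Nat.Partition.restricted]
  rw [Finset.filter_true_of_mem, Finset.card_univ]
  intro p _ i hi
  exact (Nat.Partition.le_of_mem_parts hi).trans h

lemma card_restricted_le (m N : ℕ) :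
    (Nat.Partition.restricted m (· ≤ N)).card ≤ Fintype.card (Nat.Partition m) :=
  Finset.card_le_univ _

/-- `F` converges absolutely at `q`, with value `v`. -/
def EvalsTo (F : ℂ⟦X⟧) (q v : ℂ) : Prop :=
  Summable (fun n ↦ ‖coeff n F * q ^ n‖) ∧ ∑' n, coeff n F * q ^ n = v

lemma EvalsTo.one (q : ℂ) : EvalsTo 1 q 1 := by
  have h : HasSum (fun n ↦ coeff n (1 : ℂ⟦X⟧) * q ^ n) 1 := by
    convert hasSum_ite_eq 0 (1 : ℂ) using 2 with n
    rw [coeff_one]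
    split_ifs with hn <;> simp [hn]
  exact ⟨h.summable.norm, h.tsum_eq⟩

lemma EvalsTo.mul {F G : ℂ⟦X⟧} {q v w : ℂ} (hF : EvalsTo F q v) (hG : EvalsTo G q w) :
    EvalsTo (F * G) q (v * w) := by
  have key : ∀ n, ∑ kl ∈ antidiagonal n, coeff kl.1 F * q ^ kl.1 * (coeff kl.2 G * q ^ kl.2) =
      coeff n (F * G) * q ^ n := by
    intro n
    rw [coeff_mul, sum_mul]
    refine sum_congr rfl fun kl hkl ↦ ?_
    rw [← mem_antidiagonal.1 hkl, pow_add]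
    ring
  refine ⟨?_, ?_⟩
  · simpa only [key] using summable_norm_sum_mul_antidiagonal_of_summable_norm hF.1 hG.1
  · rw [← hF.2, ← hG.2, tsum_mul_tsum_eq_tsum_sum_antidiagonal_of_summable_norm hF.1 hG.1]
    simp only [key]

lemma EvalsTo.pow {F : ℂ⟦X⟧} {q v : ℂ} (hF : EvalsTo F q v) (k : ℕ) :
    EvalsTo (F ^ k) q (v ^ k) := by
  induction k with
  | zero => simpa using EvalsTo.one q
  | succ k ih => simpa only [pow_succ] using ih.mul hF

lemma EvalsTo.prod {ι : Type*} {F : ι → ℂ⟦X⟧} {q : ℂ} {v : ι → ℂ} (s : Finset ι)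
    (h : ∀ i ∈ s, EvalsTo (F i) q (v i)) : EvalsTo (∏ i ∈ s, F i) q (∏ i ∈ s, v i) := by
  classical
  induction s using Finset.induction_on with
  | empty => simpa using EvalsTo.one q
  | insert a s ha ih =>
    rw [prod_insert ha, prod_insert ha]
    exact (h a (mem_insert_self a s)).mul (ih fun i hi ↦ h i (mem_insert_of_mem hi))

lemma evalsTo_geomSeries {k : ℕ} (hk : 0 < k) {q : ℂ} (hq : ‖q‖ < 1) :
    EvalsTo (geomSeries ℂ k) q (1 - q ^ k)⁻¹ := by
  have h := hasSum_geometric_of_norm_lt_one (ξ := q ^ k)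
    (by rw [norm_pow]; exact pow_lt_one₀ (norm_nonneg q) hq hk.ne')
  have hinj : Function.Injective (fun j : ℕ ↦ k * j) := fun a b hab ↦
    Nat.eq_of_mul_eq_mul_left hk hab
  have h2 : HasSum (fun n ↦ coeff n (geomSeries ℂ k) * q ^ n) (1 - q ^ k)⁻¹ := by
    rw [← hinj.hasSum_iff]
    · simpa [Function.comp_def, geomSeries, pow_mul] using h
    · intro n hn
      simp only [geomSeries, coeff_mk]
      rw [if_neg, zero_mul]
      rintro ⟨j, rfl⟩
      exact hn ⟨j, rfl⟩
  exact ⟨h2.summable.norm, h2.tsum_eq⟩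

lemma evalsTo_boundedSeries (N : ℕ) {q : ℂ} (hq : ‖q‖ < 1) :
    EvalsTo (boundedSeries ℂ N) q (∏ i ∈ range N, (1 - q ^ (i + 1)))⁻¹ := by
  rw [boundedSeries_eq_prod, ← prod_inv_distrib]
  exact EvalsTo.prod _ fun i _ ↦ evalsTo_geomSeries (Nat.succ_pos i) hq

lemma tprod_one_sub_pow_ne_zero {q : ℂ} (hq : ‖q‖ < 1) : ∏' i : ℕ, (1 - q ^ (i + 1)) ≠ 0 := by
  simp_rw [sub_eq_add_neg]
  refine tprod_one_add_ne_zero_of_summable (fun i ↦ ?_) ?_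
  · rw [← sub_eq_add_neg, sub_ne_zero]
    intro h
    have := congrArg norm h
    rw [norm_one, norm_pow] at this
    exact absurd this.symm (pow_lt_one₀ (norm_nonneg q) hq (Nat.succ_ne_zero i)).ne
  · simpa using (summable_nat_add_iff 1).mpr (summable_geometric_of_lt_one (norm_nonneg q) hq)

lemma tendsto_prod_inv {q : ℂ} (hq : ‖q‖ < 1) :
    Filter.Tendsto (fun N ↦ (∏ i ∈ range N, (1 - q ^ (i + 1)))⁻¹) Filter.atTop
      (nhds (∏' i : ℕ, (1 - q ^ (i + 1)))⁻¹) :=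
  ((ModularForm.multipliable_one_sub_pow hq).hasProd.tendsto_prod_nat).inv₀
    (tprod_one_sub_pow_ne_zero hq)

lemma summable_partition {r : ℝ} (hr : 0 ≤ r) (hr1 : r < 1) :
    Summable fun m ↦ (Fintype.card (Nat.Partition m) : ℝ) * r ^ m := by
  have hq : ‖(r : ℂ)‖ < 1 := by simpa [abs_of_nonneg hr] using hr1
  obtain ⟨C, hC⟩ := (tendsto_prod_inv hq).norm.bddAbove_range
  refine summable_of_sum_range_le (c := C) (fun m ↦ by positivity) fun N ↦ ?_
  have hE := evalsTo_boundedSeries N hq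
  have hterm : ∀ m, coeff m (boundedSeries ℂ N) * (r : ℂ) ^ m =
      (((Nat.Partition.restricted m (· ≤ N)).card * r ^ m : ℝ) : ℂ) := by
    intro m; simp [boundedSeries]
  have hS : Summable fun m ↦ ((Nat.Partition.restricted m (· ≤ N)).card : ℝ) * r ^ m := by
    have := hE.1
    simp only [hterm, Complex.norm_real, Real.norm_eq_abs] at this
    exact this.of_abs
  calc ∑ m ∈ range N, (Fintype.card (Nat.Partition m) : ℝ) * r ^ m
      = ∑ m ∈ range N, ((Nat.Partition.restricted m (· ≤ N)).card : ℝ) * r ^ m := by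
        refine sum_congr rfl fun m hm ↦ ?_
        have := coeff_boundedSeries_of_le ℝ (mem_range.1 hm).le
        simp only [boundedSeries, partitionSeries, coeff_mk] at this
        rw [this]
    _ ≤ ∑' m, ((Nat.Partition.restricted m (· ≤ N)).card : ℝ) * r ^ m :=
        hS.sum_le_tsum _ fun m _ ↦ by positivity
    _ = ‖(∏ i ∈ range N, (1 - (r : ℂ) ^ (i + 1)))⁻¹‖ := by
        rw [← hE.2]
        simp only [hterm]
        rw [← Complex.ofReal_tsum, Complex.norm_real, Real.norm_of_nonneg]
        exact tsum_nonneg fun m ↦ by positivity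
    _ ≤ C := hC ⟨N, rfl⟩

lemma evalsTo_partitionSeries {q : ℂ} (hq : ‖q‖ < 1) :
    EvalsTo (partitionSeries ℂ) q (∏' i : ℕ, (1 - q ^ (i + 1)))⁻¹ := by
  have hS := summable_partition (norm_nonneg q) hq
  have hS' : Summable fun m ↦ ‖coeff m (partitionSeries ℂ) * q ^ m‖ := by
    simpa [partitionSeries] using hS
  refine ⟨hS', ?_⟩
  refine tendsto_nhds_unique ?_ (tendsto_prod_inv hq)
  have heq : ∀ N, (∏ i ∈ range N, (1 - q ^ (i + 1)))⁻¹ =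
      ∑' m, coeff m (boundedSeries ℂ N) * q ^ m := fun N ↦ (evalsTo_boundedSeries N hq).2.symm
  simp only [heq]
  refine tendsto_tsum_of_dominated_convergence hS (fun m ↦ ?_) ?_
  · refine tendsto_const_nhds.congr' ?_
    filter_upwards [Filter.eventually_ge_atTop m] with N hN
    rw [coeff_boundedSeries_of_le ℂ hN]
  · refine Filter.Eventually.of_forall fun N m ↦ ?_
    simp only [boundedSeries, coeff_mk, norm_mul, norm_pow, Complex.norm_natCast]
    gcongr
    exact card_restricted_le m N

/-- The value of the generating function of `multiCount`. -/
noncomputable def multiGen (q : ℂ) : ℂ := ∑' m, (multiCount m : ℂ) * q ^ m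

lemma summable_multiCount {q : ℂ} (hq : ‖q‖ < 1) :
    Summable fun m ↦ (multiCount m : ℝ) * ‖q‖ ^ m := by
  simpa [coeff_partitionSeries_pow] using ((evalsTo_partitionSeries hq).pow 24).1

lemma multiGen_eq {q : ℂ} (hq : ‖q‖ < 1) :
    multiGen q = ((∏' i : ℕ, (1 - q ^ (i + 1))) ^ 24)⁻¹ := by
  simpa [multiGen, coeff_partitionSeries_pow] using ((evalsTo_partitionSeries hq).pow 24).2

end PartitionSeries

namespace PartitionSeries

open PowerSeries Finset

/-- Coefficientwise sum of two lists, truncated to the shorter one. -/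
def listAdd : List ℤ → List ℤ → List ℤ
  | a :: as, b :: bs => (a + b) :: listAdd as bs
  | _, _ => []

/-- Multiply every entry by `c`. -/
def listScale (c : ℤ) : List ℤ → List ℤ
  | [] => []
  | b :: bs => (c * b) :: listScale c bs

/-- The list of `L` zeros. -/
def listZero : ℕ → List ℤ
  | 0 => []
  | n + 1 => 0 :: listZero n

/-- Product of two polynomials given by coefficient lists, truncated to degree `< L`. -/
def listMul (L : ℕ) : List ℤ → List ℤ → List ℤ
  | [], _ => listZero L
  | a :: as, bs => listAdd (listScale a bs) (0 :: listMul L as bs)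

/-- Multiplication by `1 - X ^ k` on coefficient lists. -/
def listMulOneSub (k : ℕ) (l : List ℤ) : List ℤ :=
  listAdd l (listZero k ++ listScale (-1) l)

/-- Coefficient list of `∏ i < N, (1 - X ^ (i + 1))` truncated to degree `< L`. -/
def listEuler (L : ℕ) : ℕ → List ℤ
  | 0 => 1 :: listZero (L - 1)
  | N + 1 => listMulOneSub (N + 1) (listEuler L N)

/-- The sum of products of corresponding entries. -/
def listDot : List ℤ → List ℤ → ℤ
  | a :: as, b :: bs => a * b + listDot as bs
  | _, _ => 0

/-- The reversed coefficient list of the inverse of the series `1 + X * e`,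
computed up to `n` terms after the initial one. -/
def listInvRev (e : List ℤ) : ℕ → List ℤ
  | 0 => [1]
  | n + 1 =>
    let l := listInvRev e n
    (-listDot e l) :: l

/-- The `24`th power of a coefficient list. -/
def listPow24 (L : ℕ) (l : List ℤ) : List ℤ :=
  let l2 := listMul L l l
  let l4 := listMul L l2 l2
  let l8 := listMul L l4 l4
  listMul L l8 (listMul L l8 l8)

/-- Coefficient list of `∏ (1 - X ^ i) ^ 24` up to degree `64`. -/
def listDelta : List ℤ := listPow24 65 (listEuler 65 64)

/-- Coefficient list of `∏ (1 - X ^ i) ^ (-24)` up to degree `64`. -/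
def listCount : List ℤ := (listInvRev listDelta.tail 64).reverse

theorem listMul_listCount : listMul 65 listCount listDelta = 1 :: listZero 64 := by
  decide +kernel

/-- The power series with the given coefficient list. -/
noncomputable def listSeries : List ℤ → ℤ⟦X⟧
  | [] => 0
  | a :: l => C a + X * listSeries l

lemma coeff_listSeries (l : List ℤ) (m : ℕ) : coeff m (listSeries l) = l.getD m 0 := by
  induction l generalizing m with
  | nil => simp [listSeries]
  | cons a l ih =>
    cases m with
    | zero => simp [listSeries]
    | succ m =>
      rw [listSeries, map_add, coeff_succ_X_mul, ih, coeff_C]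
      simp

lemma listSeries_listScale (c : ℤ) (l : List ℤ) :
    listSeries (listScale c l) = C c * listSeries l := by
  induction l with
  | nil => simp [listSeries, listScale]
  | cons a l ih => simp only [listSeries, listScale, ih, map_mul]; ring

lemma length_listScale (c : ℤ) (l : List ℤ) : (listScale c l).length = l.length := by
  induction l with
  | nil => rfl
  | cons a l ih => simp [listScale, ih]

lemma listSeries_listZero_append (n : ℕ) (l : List ℤ) :
    listSeries (listZero n ++ l) = X ^ n * listSeries l := by
  induction n with
  | zero => simp [listZero]
  | succ n ih =>
    simp only [listZero, List.cons_append, listSeries, ih, map_zero, zero_add]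
    ring

lemma listSeries_listZero (n : ℕ) : listSeries (listZero n) = 0 := by
  simpa [listSeries] using listSeries_listZero_append n []

lemma length_listZero (n : ℕ) : (listZero n).length = n := by
  induction n with
  | zero => rfl
  | succ n ih => simp [listZero, ih]

lemma length_listAdd {L : ℕ} {a b : List ℤ} (ha : a.length = L) (hb : L ≤ b.length) :
    (listAdd a b).length = L := by
  induction a generalizing b L with
  | nil => simpa [listAdd] using ha
  | cons x a ih =>
    cases b with
    | nil => simp at hb; simp [hb] at ha
    | cons y b =>
      subst ha
      simpa [listAdd] using ih (L := a.length) (b := b) rfl (by simpa using hb)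

lemma listSeries_listAdd {L : ℕ} {a b : List ℤ} (ha : a.length = L) (hb : L ≤ b.length) :
    X ^ L ∣ listSeries (listAdd a b) - (listSeries a + listSeries b) := by
  induction a generalizing b L with
  | nil => simp at ha; simp [← ha]
  | cons x a ih =>
    cases b with
    | nil => simp at hb; simp [hb] at ha
    | cons y b =>
      subst ha
      obtain ⟨F, hF⟩ := ih (L := a.length) (b := b) rfl (by simpa using hb)
      refine ⟨F, ?_⟩
      simp only [listAdd, listSeries, List.length_cons, map_add]
      linear_combination X * hF

lemma length_listMul {L : ℕ} (a : List ℤ) {b : List ℤ} (hb : b.length = L) :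
    (listMul L a b).length = L := by
  induction a with
  | nil => simp [listMul, length_listZero]
  | cons x a ih =>
    exact length_listAdd (by rw [length_listScale, hb]) (by simp [ih])

lemma listSeries_listMul {L : ℕ} (a : List ℤ) {b : List ℤ} (hb : b.length = L) :
    X ^ L ∣ listSeries (listMul L a b) - listSeries a * listSeries b := by
  induction a with
  | nil => simp [listMul, listSeries_listZero, listSeries]
  | cons x a ih =>
    obtain ⟨F, hF⟩ := listSeries_listAdd (L := L) (a := listScale x b)
      (b := 0 :: listMul L a b) (by rw [length_listScale, hb]) (by simp [length_listMul a hb])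
    obtain ⟨G, hG⟩ := ih
    refine ⟨F + X * G, ?_⟩
    simp only [listSeries_listScale, listSeries, map_zero, zero_add] at hF
    simp only [listMul, listSeries]
    linear_combination hF + X * hG

lemma length_listEuler {L : ℕ} (hL : 0 < L) (N : ℕ) : (listEuler L N).length = L := by
  induction N with
  | zero => simp [listEuler, length_listZero]; omega
  | succ N ih =>
    exact length_listAdd ih (by simp [length_listScale, ih])

lemma listSeries_listEuler {L : ℕ} (hL : 0 < L) (N : ℕ) :
    X ^ L ∣ listSeries (listEuler L N) - ∏ i ∈ range N, (1 - X ^ (i + 1)) := by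
  induction N with
  | zero => simp [listEuler, listSeries, listSeries_listZero]
  | succ N ih =>
    obtain ⟨F, hF⟩ := listSeries_listAdd (L := L) (a := listEuler L N)
      (b := listZero (N + 1) ++ listScale (-1) (listEuler L N)) (length_listEuler hL N)
      (by simp [length_listScale, length_listEuler hL N])
    obtain ⟨G, hG⟩ := ih
    refine ⟨F + G * (1 - X ^ (N + 1)), ?_⟩
    rw [listSeries_listZero_append, listSeries_listScale] at hF
    rw [prod_range_succ]
    simp only [listEuler, listMulOneSub]
    simp only [map_neg, map_one] at hF
    linear_combination hF + hG * (1 - X ^ (N + 1))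

lemma dvd_listMul_sub_mul {L : ℕ} {a b : List ℤ} {F G : ℤ⟦X⟧} (hb : b.length = L)
    (hF : X ^ L ∣ listSeries a - F) (hG : X ^ L ∣ listSeries b - G) :
    X ^ L ∣ listSeries (listMul L a b) - F * G := by
  obtain ⟨U, hU⟩ := hF
  obtain ⟨V, hV⟩ := hG
  obtain ⟨W, hW⟩ := listSeries_listMul a hb
  refine ⟨W + U * listSeries b + F * V, ?_⟩
  linear_combination hW + hU * listSeries b + hV * F

lemma dvd_listPow24_sub {L : ℕ} {a : List ℤ} {F : ℤ⟦X⟧} (ha : a.length = L)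
    (hF : X ^ L ∣ listSeries a - F) : X ^ L ∣ listSeries (listPow24 L a) - F ^ 24 := by
  have h2 := dvd_listMul_sub_mul ha hF hF
  have l2 := length_listMul a ha
  have h4 := dvd_listMul_sub_mul l2 h2 h2
  have l4 := length_listMul (listMul L a a) l2
  have h8 := dvd_listMul_sub_mul l4 h4 h4
  have l8 := length_listMul (listMul L (listMul L a a) (listMul L a a)) l4
  have h := dvd_listMul_sub_mul (length_listMul _ l8) h8 (dvd_listMul_sub_mul l8 h8 h8)
  rwa [show F ^ 24 = F * F * (F * F) * (F * F * (F * F)) *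
    (F * F * (F * F) * (F * F * (F * F)) * (F * F * (F * F) * (F * F * (F * F)))) by ring]

lemma length_listPow24 {L : ℕ} {a : List ℤ} (ha : a.length = L) :
    (listPow24 L a).length = L :=
  length_listMul _ (length_listMul _ (length_listMul _ (length_listMul _ (length_listMul _ ha))))

lemma dvd_listCount_sub :
    (X : ℤ⟦X⟧) ^ 65 ∣ listSeries listCount - boundedSeries ℤ 64 ^ 24 := by
  have hE := listSeries_listEuler (L := 65) (by norm_num) 64
  have hlen := length_listEuler (L := 65) (by norm_num) 64
  obtain ⟨U, hU⟩ : (X : ℤ⟦X⟧) ^ 65 ∣ listSeries listDelta - _ := dvd_listPow24_sub hlen hE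
  obtain ⟨V, hV⟩ := listSeries_listMul listCount (b := listDelta) (length_listPow24 hlen)
  have hB : boundedSeries ℤ 64 ^ 24 * (∏ i ∈ range 64, (1 - X ^ (i + 1))) ^ 24 = 1 := by
    rw [← mul_pow, boundedSeries_mul, one_pow]
  rw [listMul_listCount, show listSeries (1 :: listZero 64) = 1 by
    simp [listSeries, listSeries_listZero]] at hV
  refine ⟨-boundedSeries ℤ 64 ^ 24 * (V + listSeries listCount * U), ?_⟩
  linear_combination -boundedSeries ℤ 64 ^ 24 * hV - boundedSeries ℤ 64 ^ 24 *
    listSeries listCount * hU - listSeries listCount * hB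

lemma multiCount_eq_getD {m : ℕ} (hm : m < 65) : (multiCount m : ℤ) = listCount.getD m 0 := by
  have h1 : (X : ℤ⟦X⟧) ^ 65 ∣ boundedSeries ℤ 64 - partitionSeries ℤ := by
    rw [X_pow_dvd_iff]
    intro i hi
    rw [map_sub, coeff_boundedSeries_of_le ℤ (by omega), sub_self]
  have h2 := dvd_add dvd_listCount_sub (h1.trans (sub_dvd_pow_sub_pow _ _ 24))
  rw [sub_add_sub_cancel, X_pow_dvd_iff] at h2
  have h3 := h2 m hm
  rw [map_sub, coeff_listSeries, coeff_partitionSeries_pow] at h3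
  simpa using (sub_eq_zero.1 h3).symm

end PartitionSeries

namespace PartitionSeries

/-- The summand `a ^ k / (k! (k + 13)!)` of the normalized Bessel series. -/
noncomputable def besselTerm (a : ℝ) (k : ℕ) : ℝ :=
  a ^ k / (k.factorial * (k + 13).factorial)

lemma besselTerm_nonneg {a : ℝ} (ha : 0 ≤ a) (k : ℕ) : 0 ≤ besselTerm a k := by
  unfold besselTerm; positivity

lemma besselTerm_succ (a : ℝ) (k : ℕ) :
    besselTerm a (k + 1) = besselTerm a k * (a / ((k + 1) * (k + 14))) := by
  unfold besselTerm
  rw [show k + 1 + 13 = (k + 13) + 1 by ring, Nat.factorial_succ, Nat.factorial_succ (k + 13)]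
  push_cast
  field_simp
  ring

lemma summable_besselTerm {a : ℝ} (ha : 0 ≤ a) : Summable (besselTerm a) := by
  refine (Real.summable_pow_div_factorial a).of_nonneg_of_le (besselTerm_nonneg ha) fun k ↦ ?_
  unfold besselTerm
  gcongr
  have : (1 : ℝ) ≤ (k + 13).factorial := by exact_mod_cast Nat.factorial_pos _
  nlinarith [show (0 : ℝ) < k.factorial by positivity]

/-- The leading term `2 π n ^ (-13/2) I₁₃(4 π √n)`, as a power series in `n`. -/
noncomputable def mainTerm (n : ℝ) : ℝ :=
  (4 * π ^ 2) ^ 7 * ∑' k, besselTerm (4 * π ^ 2 * n) k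

lemma bessel_eq_mainTerm {n : ℝ} (hn : 0 < n) :
    2 * π * n ^ (-(13 : ℝ) / 2) * besselI 13 (4 * π * √n) = mainTerm n := by
  unfold besselI mainTerm
  rw [← tsum_mul_left, ← tsum_mul_left]
  congr 1
  ext k
  have hs : 0 < √n := Real.sqrt_pos.2 hn
  have hpow : n ^ (-(13 : ℝ) / 2) = (√n ^ 13)⁻¹ := by
    rw [Real.sqrt_eq_rpow, ← Real.rpow_natCast, ← Real.rpow_mul hn.le, ← Real.rpow_neg hn.le]
    norm_num
  have hG : Real.Gamma ((k : ℝ) + 13 + 1) = (k + 13).factorial := by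
    rw [← Real.Gamma_nat_eq_factorial]; push_cast; ring_nf
  have hx : (4 * π * √n / 2) ^ (2 * (k : ℝ) + 13) = (2 * π * √n) ^ (2 * k + 13) := by
    rw [← Real.rpow_natCast]
    push_cast
    congr 1
    ring
  have hn2 : n = √n ^ 2 := (Real.sq_sqrt hn.le).symm
  rw [hpow, hG, hx, besselTerm]
  rw [show 4 * π ^ 2 * n = (2 * π * √n) ^ 2 by rw [mul_pow, ← hn2]; ring, ← pow_mul]
  field_simp
  ring

lemma tsum_besselTerm_succ {a : ℝ} (ha : 0 ≤ a) (k : ℕ) :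
    ∑' j, besselTerm a (j + k) = besselTerm a k + ∑' j, besselTerm a (j + (k + 1)) := by
  rw [((summable_nat_add_iff k).2 (summable_besselTerm ha)).tsum_eq_zero_add]
  simp only [zero_add]
  congr 3
  ext j
  congr 1
  ring

/-- Fixed-point lower bound, scaled by `10 ^ 12`, for the series of `besselTerm` from index `k`
on relative to its first term, using `f` further terms. -/
def besselLower (A : ℕ) : ℕ → ℕ → ℕ
  | 0, _ => 10 ^ 12
  | f + 1, k => 10 ^ 12 + besselLower A f (k + 1) * A / (10000 * ((k + 1) * (k + 14)))

/-- Fixed-point upper bound, scaled by `10 ^ 12`, for the series of `besselTerm` from index `k`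
on relative to its first term, using `f` further terms. -/
def besselUpper (A : ℕ) : ℕ → ℕ → ℕ
  | 0, _ => 2 * 10 ^ 12
  | f + 1, k => 10 ^ 12 + (besselUpper A f (k + 1) * A / (10000 * ((k + 1) * (k + 14))) + 1)

lemma besselLower_le {a : ℝ} {A : ℕ} (hA : (A : ℝ) / 10000 ≤ a) (f k : ℕ) :
    besselTerm a k * (besselLower A f k / 10 ^ 12) ≤ ∑' j, besselTerm a (j + k) := by
  have ha : 0 ≤ a := le_trans (by positivity) hA
  induction f generalizing k with
  | zero =>
    rw [tsum_besselTerm_succ ha]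
    have h : 0 ≤ ∑' j, besselTerm a (j + (k + 1)) := tsum_nonneg fun j ↦ besselTerm_nonneg ha _
    norm_num [besselLower]
    linarith
  | succ f ih =>
    rw [tsum_besselTerm_succ ha]
    have h1 := ih (k + 1)
    have h2 : ((besselLower A f (k + 1) * A / (10000 * ((k + 1) * (k + 14))) : ℕ) : ℝ) ≤
        besselLower A f (k + 1) * (a / ((k + 1) * (k + 14))) := by
      refine Nat.cast_div_le.trans ?_
      push_cast
      calc (besselLower A f (k + 1) * A / (10000 * ((k + 1) * (k + 14))) : ℝ)
          = besselLower A f (k + 1) * (A / 10000 / ((k + 1) * (k + 14))) := by field_simp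
        _ ≤ _ := by gcongr
    calc besselTerm a k * (besselLower A (f + 1) k / 10 ^ 12)
        ≤ besselTerm a k * ((10 ^ 12 + besselLower A f (k + 1) *
            (a / ((k + 1) * (k + 14)))) / 10 ^ 12) := by
          have := besselTerm_nonneg ha k
          simp only [besselLower]
          push_cast at h2 ⊢
          gcongr
          norm_num
      _ = besselTerm a k + besselTerm a (k + 1) * (besselLower A f (k + 1) / 10 ^ 12) := by
          rw [besselTerm_succ]; field_simp
      _ ≤ _ := by gcongr

lemma le_besselUpper {a : ℝ} {A : ℕ} (ha : 0 ≤ a) (hA : a ≤ (A : ℝ) / 10000) (f k : ℕ)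
    (hk : 2 * a ≤ ((k + f : ℕ) + 1) * ((k + f : ℕ) + 14)) :
    ∑' j, besselTerm a (j + k) ≤ besselTerm a k * (besselUpper A f k / 10 ^ 12) := by
  induction f generalizing k with
  | zero =>
    have hterm : ∀ j, besselTerm a (j + k) ≤ besselTerm a k * (1 / 2) ^ j := by
      intro j
      induction j with
      | zero => simp
      | succ j ih =>
        rw [show j + 1 + k = (j + k) + 1 by ring, besselTerm_succ, pow_succ, ← mul_assoc]
        refine mul_le_mul ih ?_ (by positivity)
          (mul_nonneg (besselTerm_nonneg ha k) (by positivity))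
        rw [div_le_div_iff₀ (by positivity) (by norm_num)]
        push_cast
        simp only [add_zero] at hk
        have hj : (0 : ℝ) ≤ j := by positivity
        have hk0 : (0 : ℝ) ≤ k := by positivity
        nlinarith
    have hg : HasSum (fun j : ℕ ↦ besselTerm a k * (1 / 2) ^ j) (besselTerm a k * 2) :=
      hasSum_geometric_two.mul_left _
    calc ∑' j, besselTerm a (j + k) ≤ ∑' j : ℕ, besselTerm a k * (1 / 2) ^ j :=
          ((summable_nat_add_iff k).2 (summable_besselTerm ha)).tsum_le_tsum hterm hg.summable
      _ = besselTerm a k * 2 := hg.tsum_eq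
      _ = _ := by norm_num [besselUpper]
  | succ f ih =>
    rw [tsum_besselTerm_succ ha]
    have h1 := ih (k + 1) (by rwa [show k + 1 + f = k + (f + 1) by ring])
    have h2 : besselUpper A f (k + 1) * (a / ((k + 1) * (k + 14))) ≤
        ((besselUpper A f (k + 1) * A / (10000 * ((k + 1) * (k + 14))) + 1 : ℕ) : ℝ) := by
      have hlt := (Nat.lt_div_mul_add (a := besselUpper A f (k + 1) * A)
        (b := 10000 * ((k + 1) * (k + 14))) (by positivity)).le
      have hlt' : (besselUpper A f (k + 1) * A : ℝ) ≤
          ((besselUpper A f (k + 1) * A / (10000 * ((k + 1) * (k + 14))) + 1 : ℕ) : ℝ) *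
            (10000 * ((k + 1) * (k + 14))) := by
        rw [← Nat.succ_mul] at hlt
        exact_mod_cast hlt
      calc besselUpper A f (k + 1) * (a / ((k + 1) * (k + 14)))
          ≤ besselUpper A f (k + 1) * (A / 10000 / ((k + 1) * (k + 14))) := by gcongr
        _ = besselUpper A f (k + 1) * A / (10000 * ((k + 1) * (k + 14))) := by field_simp
        _ ≤ _ := by
          rw [div_le_iff₀ (by positivity)]
          exact hlt'
    calc besselTerm a k + ∑' j, besselTerm a (j + (k + 1))
        ≤ besselTerm a k + besselTerm a (k + 1) * (besselUpper A f (k + 1) / 10 ^ 12) := by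
          gcongr
      _ = besselTerm a k * ((10 ^ 12 + besselUpper A f (k + 1) *
            (a / ((k + 1) * (k + 14)))) / 10 ^ 12) := by
          rw [besselTerm_succ]; field_simp
      _ ≤ besselTerm a k * (besselUpper A (f + 1) k / 10 ^ 12) := by
          have := besselTerm_nonneg ha k
          simp only [besselUpper]
          push_cast at h2 ⊢
          gcongr
          norm_num

theorem besselUpper_lt_listCount : ∀ n < 64, 1 ≤ n →
    11 * (394785 ^ 7 * (besselUpper (394785 * n) 80 0 : ℤ)) <
      12 * (listCount.getD (n + 1) 0 * (Nat.factorial 13 * 10 ^ 40)) := by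
  decide +kernel

theorem listCount_lt_besselLower : ∀ n < 64, 1 ≤ n →
    12 * (listCount.getD (n + 1) 0 * (Nat.factorial 13 * 10 ^ 40)) <
      13 * (394784 ^ 7 * (besselLower (394784 * n) 80 0 : ℤ)) := by
  decide +kernel

lemma four_pi_sq_bounds : (394784 : ℝ) / 10000 ≤ 4 * π ^ 2 ∧ 4 * π ^ 2 ≤ 394785 / 10000 := by
  have h1 := Real.pi_gt_d6
  have h2 := Real.pi_lt_d6
  constructor <;> nlinarith

lemma mainTerm_lower (n : ℕ) :
    394784 ^ 7 * (besselLower (394784 * n) 80 0 : ℝ) / (Nat.factorial 13 * 10 ^ 40) ≤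
      mainTerm n := by
  have hX := four_pi_sq_bounds.1
  have h := besselLower_le (a := 4 * π ^ 2 * n) (A := 394784 * n)
    (by push_cast; rw [mul_div_right_comm]; gcongr) 80 0
  simp only [add_zero] at h
  unfold mainTerm
  calc 394784 ^ 7 * (besselLower (394784 * n) 80 0 : ℝ) / (Nat.factorial 13 * 10 ^ 40)
      = (394784 / 10000) ^ 7 * (besselTerm (4 * π ^ 2 * n) 0 *
        (besselLower (394784 * n) 80 0 / 10 ^ 12)) := by
        simp only [besselTerm, pow_zero, Nat.factorial_zero, zero_add]
        field_simp
        norm_num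
    _ ≤ _ := by
        have := besselTerm_nonneg (a := 4 * π ^ 2 * n) (by positivity) 0
        gcongr

lemma mainTerm_upper {n : ℕ} (hn : n < 64) :
    mainTerm n ≤
      394785 ^ 7 * (besselUpper (394785 * n) 80 0 : ℝ) / (Nat.factorial 13 * 10 ^ 40) := by
  have hX := four_pi_sq_bounds.2
  have hn' : (n : ℝ) ≤ 64 := by exact_mod_cast hn.le
  have h := le_besselUpper (a := 4 * π ^ 2 * n) (A := 394785 * n) (by positivity)
    (by push_cast; rw [mul_div_right_comm]; gcongr) 80 0
    (by push_cast; nlinarith [show (0 : ℝ) ≤ n by positivity])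
  simp only [add_zero] at h
  unfold mainTerm
  calc (4 * π ^ 2) ^ 7 * ∑' k, besselTerm (4 * π ^ 2 * n) k
      ≤ (394785 / 10000) ^ 7 * (besselTerm (4 * π ^ 2 * n) 0 *
        (besselUpper (394785 * n) 80 0 / 10 ^ 12)) := by
        have : 0 ≤ ∑' k, besselTerm (4 * π ^ 2 * n) k :=
          tsum_nonneg fun k ↦ besselTerm_nonneg (by positivity) k
        gcongr
    _ = _ := by
        simp only [besselTerm, pow_zero, Nat.factorial_zero, zero_add]
        field_simp
        norm_num
        ring

lemma bounds_of_lt {n : ℕ} (hn : 1 ≤ n) (hn64 : n < 64) :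
    (1 - 1 / 12) * mainTerm n < multiCount (n + 1) ∧
      (multiCount (n + 1) : ℝ) < (1 + 1 / 12) * mainTerm n := by
  have hc : ((listCount.getD (n + 1) 0 : ℤ) : ℝ) = multiCount (n + 1) := by
    rw [← multiCount_eq_getD (by omega)]; simp
  have h1 : (11 * (394785 ^ 7 * (besselUpper (394785 * n) 80 0 : ℝ)) : ℝ) <
      12 * (multiCount (n + 1) * (Nat.factorial 13 * 10 ^ 40)) := by
    rw [← hc]; exact_mod_cast besselUpper_lt_listCount n hn64 hn
  have h2 : (12 * (multiCount (n + 1) * (Nat.factorial 13 * 10 ^ 40)) : ℝ) <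
      13 * (394784 ^ 7 * (besselLower (394784 * n) 80 0 : ℝ)) := by
    rw [← hc]; exact_mod_cast listCount_lt_besselLower n hn64 hn
  have h3 := mainTerm_upper hn64
  have h4 := mainTerm_lower n
  have hpos : (0 : ℝ) < Nat.factorial 13 * 10 ^ 40 := by positivity
  rw [le_div_iff₀ hpos] at h3
  rw [div_le_iff₀ hpos] at h4
  generalize (Nat.factorial 13 * 10 ^ 40 : ℝ) = Q at *
  constructor
  · refine lt_of_mul_lt_mul_right ?_ hpos.le
    linarith
  · refine lt_of_mul_lt_mul_right ?_ hpos.le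
    linarith

end PartitionSeries

namespace PartitionSeries

open Complex (I)

/-- The nome `exp (2 π i τ)`. -/
noncomputable def nome (τ : ℂ) : ℂ := Complex.exp (2 * π * I * τ)

lemma nome_ne_zero (τ : ℂ) : nome τ ≠ 0 := Complex.exp_ne_zero _

lemma norm_nome (τ : ℂ) : ‖nome τ‖ = exp (-(2 * π * τ.im)) := by
  simp [nome, Complex.norm_exp, mul_assoc]

lemma norm_nome_lt_one {τ : ℂ} (hτ : 0 < τ.im) : ‖nome τ‖ < 1 := by
  rw [norm_nome, Real.exp_lt_one_iff]
  have := Real.pi_pos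
  simp only [Left.neg_neg_iff]
  positivity

/-- The reciprocal of the modular discriminant. -/
noncomputable def invDisc (τ : ℂ) : ℂ := (nome τ)⁻¹ * multiGen (nome τ)

lemma invDisc_eq {τ : ℂ} (hτ : 0 < τ.im) : invDisc τ = (ModularForm.eta τ ^ 24)⁻¹ := by
  have h1 : Function.Periodic.qParam 24 τ ^ 24 = nome τ := by
    rw [nome, Function.Periodic.qParam, ← Complex.exp_nat_mul]
    congr 1
    push_cast
    ring
  have h2 : ∏' i : ℕ, (1 - ModularForm.eta_q i τ) = ∏' i : ℕ, (1 - nome τ ^ (i + 1)) :=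
    tprod_congr fun i ↦ by rw [ModularForm.eta_q_eq_pow, nome]
  rw [invDisc, multiGen_eq (norm_nome_lt_one hτ), ← mul_inv, ModularForm.eta, mul_pow, h1, h2]

lemma im_neg_inv_pos {τ : ℂ} (hτ : 0 < τ.im) : 0 < (-1 / τ).im := by
  rw [neg_div, one_div, ← inv_neg, Complex.inv_im]
  have : 0 < Complex.normSq (-τ) := Complex.normSq_pos.2 fun h ↦ by simp_all
  simp only [Complex.neg_im, neg_neg]
  positivity

lemma invDisc_modular {τ : ℂ} (hτ : 0 < τ.im) : invDisc τ = τ ^ 12 * invDisc (-1 / τ) := by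
  have hτ0 : τ ≠ 0 := fun h ↦ by simp_all
  have h : ModularForm.eta (-1 / τ) = (Complex.sqrt I)⁻¹ * (Complex.sqrt τ * ModularForm.eta τ) := by
    simpa using ModularForm.eta_comp_eq_csqrt_I_inv hτ
  have h24 : ∀ z : ℂ, z ≠ 0 → Complex.sqrt z ^ 24 = z ^ 12 := by
    intro z hz
    rw [sqrt_eq_exp hz, ← Complex.exp_nat_mul,
      show ((24 : ℕ) : ℂ) * (Complex.log z / 2) = (12 : ℕ) * Complex.log z by push_cast; ring,
      Complex.exp_nat_mul, Complex.exp_log hz]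
  rw [invDisc_eq hτ, invDisc_eq (im_neg_inv_pos hτ), h, mul_pow, mul_pow, inv_pow,
    h24 I Complex.I_ne_zero, h24 τ hτ0]
  have hI : I ^ 12 = 1 := by rw [show 12 = 4 * 3 by norm_num, pow_mul, Complex.I_pow_four, one_pow]
  have := ModularForm.eta_ne_zero hτ
  rw [hI]
  field_simp

/-- The regular part `∑ multiCount (m + 1) r ^ m` of the reciprocal discriminant. -/
noncomputable def regularPart (r : ℝ) : ℝ := ∑' m, (multiCount (m + 1) : ℝ) * r ^ m

/-- The generating function of `multiCount` on the real line. -/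
noncomputable def realGen (r : ℝ) : ℝ := ∑' m, (multiCount m : ℝ) * r ^ m

lemma summable_realGen {r : ℝ} (hr : 0 ≤ r) (hr1 : r < 1) :
    Summable fun m ↦ (multiCount m : ℝ) * r ^ m := by
  have := summable_multiCount (q := r) (by simpa [abs_of_nonneg hr])
  simpa [abs_of_nonneg hr] using this

lemma summable_regularPart {r : ℝ} (hr : 0 < r) (hr1 : r < 1) :
    Summable fun m ↦ (multiCount (m + 1) : ℝ) * r ^ m := by
  refine (((summable_nat_add_iff 1).2 (summable_realGen hr.le hr1)).mul_left r⁻¹).congr fun m ↦ ?_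
  rw [pow_succ]
  field_simp

lemma realGen_eq {r : ℝ} (hr : 0 < r) (hr1 : r < 1) : realGen r = 1 + r * regularPart r := by
  rw [realGen, (summable_realGen hr.le hr1).tsum_eq_zero_add, regularPart, ← tsum_mul_left]
  simp only [multiCount_zero, pow_zero, Nat.cast_one, mul_one, add_right_inj]
  congr 1
  ext m
  ring

lemma regularPart_le {r : ℝ} (hr : 0 < r) (hr1 : r < 1) : regularPart r ≤ r⁻¹ * realGen r := by
  rw [realGen_eq hr hr1]
  field_simp
  linarith

lemma regularPart_mono {r t : ℝ} (hr : 0 < r) (hrt : r ≤ t) (ht : t < 1) :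
    regularPart r ≤ regularPart t :=
  (summable_regularPart hr (hrt.trans_lt ht)).tsum_le_tsum (fun m ↦ by gcongr)
    (summable_regularPart (hr.trans_le hrt) ht)

lemma realGen_mono {r t : ℝ} (hr : 0 ≤ r) (hrt : r ≤ t) (ht : t < 1) :
    realGen r ≤ realGen t :=
  (summable_realGen hr (hrt.trans_lt ht)).tsum_le_tsum (fun m ↦ by gcongr)
    (summable_realGen (hr.trans hrt) ht)

lemma multiGen_ofReal (r : ℝ) : multiGen r = realGen r := by
  simp [multiGen, realGen, Complex.ofReal_tsum]

lemma invDisc_sub_inv {τ : ℂ} (hτ : 0 < τ.im) :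
    invDisc τ - (nome τ)⁻¹ = ∑' m, (multiCount (m + 1) : ℂ) * nome τ ^ m := by
  have hS : Summable fun m ↦ (multiCount m : ℂ) * nome τ ^ m := by
    refine .of_norm ?_
    simpa using summable_multiCount (norm_nome_lt_one hτ)
  rw [invDisc, multiGen, hS.tsum_eq_zero_add]
  simp only [multiCount_zero, pow_zero, Nat.cast_one, mul_one]
  rw [mul_add, mul_one, add_sub_cancel_left, ← tsum_mul_left]
  congr 1
  ext m
  rw [pow_succ]
  field_simp [nome_ne_zero τ]

lemma norm_invDisc_sub_inv_le {τ : ℂ} (hτ : 0 < τ.im) :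
    ‖invDisc τ - (nome τ)⁻¹‖ ≤ regularPart (exp (-(2 * π * τ.im))) := by
  rw [invDisc_sub_inv hτ, ← norm_nome]
  refine (norm_tsum_le_tsum_norm ?_).trans_eq ?_
  · simpa using summable_regularPart (norm_pos_iff.2 (nome_ne_zero τ)) (norm_nome_lt_one hτ)
  · simp [regularPart]

lemma exp_neg_two_pi_mul_lt_one {t : ℝ} (ht : 0 < t) : exp (-(2 * π * t)) < 1 := by
  rw [Real.exp_lt_one_iff, neg_lt_zero]
  positivity

lemma invDisc_mul_I (t : ℝ) :
    invDisc (t * I) = ((exp (-(2 * π * t)))⁻¹ * realGen (exp (-(2 * π * t))) : ℝ) := by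
  have : nome (t * I) = (exp (-(2 * π * t)) : ℝ) := by
    rw [nome, Complex.ofReal_exp]
    congr 1
    push_cast
    linear_combination (2 * π * t) * Complex.I_sq
  rw [invDisc, this, multiGen_ofReal]
  push_cast
  rfl

lemma realGen_modular {t : ℝ} (ht : 0 < t) :
    (exp (-(2 * π * t)))⁻¹ * realGen (exp (-(2 * π * t))) =
      t ^ 12 * ((exp (-(2 * π * t⁻¹)))⁻¹ * realGen (exp (-(2 * π * t⁻¹)))) := by
  have h := invDisc_modular (τ := t * I) (by simpa)
  have h2 : -1 / ((t : ℂ) * I) = (t⁻¹ : ℝ) * I := by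
    push_cast
    have : (t : ℂ) ≠ 0 := by exact_mod_cast ht.ne'
    field_simp
    simp
  rw [h2, invDisc_mul_I, invDisc_mul_I, mul_pow, show 12 = 4 * 3 by norm_num, pow_mul I,
    Complex.I_pow_four, one_pow, mul_one] at h
  exact_mod_cast h

lemma one_sub_sum_le_prod (x : ℝ) (hx : 0 ≤ x) (hx1 : x ≤ 1) (N : ℕ) :
    1 - ∑ i ∈ Finset.range N, x ^ (i + 1) ≤ ∏ i ∈ Finset.range N, (1 - x ^ (i + 1)) := by
  induction N with
  | zero => simp
  | succ N ih =>
    rw [Finset.sum_range_succ, Finset.prod_range_succ]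
    have h1 : ∏ i ∈ Finset.range N, (1 - x ^ (i + 1)) ≤ 1 :=
      Finset.prod_le_one (fun i _ ↦ by linarith [pow_le_one₀ (n := i + 1) hx hx1])
        (fun i _ ↦ by linarith [pow_nonneg hx (i + 1)])
    nlinarith [pow_nonneg hx (N + 1)]

lemma exp_neg_two_pi_le : exp (-(2 * π)) ≤ 1 / 500 := by
  rw [Real.exp_neg, one_div]
  refine inv_anti₀ (by norm_num) ?_
  have h1 := Real.exp_one_gt_d9
  have h2 := Real.add_one_le_exp (28 / 100 : ℝ)
  calc (500 : ℝ) ≤ 2.718 ^ 6 * (28 / 100 + 1) := by norm_num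
    _ ≤ exp 1 ^ 6 * exp (28 / 100) := by gcongr; linarith
    _ = exp 6.28 := by rw [← Real.exp_nat_mul, ← Real.exp_add]; norm_num
    _ ≤ exp (2 * π) := by rw [Real.exp_le_exp]; linarith [Real.pi_gt_d2]

lemma realGen_le_two {t : ℝ} (ht : 1 ≤ t) : realGen (exp (-(2 * π * t))) ≤ 2 := by
  set x : ℝ := exp (-(2 * π)) with hx
  have hx0 : 0 < x := Real.exp_pos _
  have hx1 : x ≤ 1 / 500 := exp_neg_two_pi_le
  have hle : exp (-(2 * π * t)) ≤ x := by
    rw [hx]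
    rw [Real.exp_le_exp]
    nlinarith [Real.pi_pos]
  refine (realGen_mono (Real.exp_pos _).le hle (by linarith)).trans ?_
  have hq : ‖(x : ℂ)‖ < 1 := by
    rw [Complex.norm_real, Real.norm_of_nonneg hx0.le]; linarith
  have hprod := (ModularForm.multipliable_one_sub_pow hq).hasProd.tendsto_prod_nat.norm
  have hlow : (498 / 499 : ℝ) ≤ ‖∏' i : ℕ, (1 - (x : ℂ) ^ (i + 1))‖ := by
    refine ge_of_tendsto' hprod fun N ↦ ?_
    have h1 := one_sub_sum_le_prod x hx0.le (by linarith) N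
    have h2 : ∑ i ∈ Finset.range N, x ^ (i + 1) ≤ 1 / 499 := by
      have hg := (hasSum_geometric_of_lt_one hx0.le (by linarith : x < 1)).mul_right x
      refine (hg.summable.sum_le_tsum (Finset.range N) (fun i _ ↦ by positivity)).trans ?_
      rw [hg.tsum_eq, inv_mul_le_iff₀ (by linarith)]
      linarith
    have h3 : ∏ i ∈ Finset.range N, (1 - (x : ℂ) ^ (i + 1)) =
        ((∏ i ∈ Finset.range N, (1 - x ^ (i + 1)) : ℝ) : ℂ) := by push_cast; rfl
    rw [h3, Complex.norm_real]
    refine le_trans ?_ (le_abs_self _)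
    linarith
  have h := multiGen_eq hq
  rw [multiGen_ofReal] at h
  have h' := congrArg norm h
  rw [Complex.norm_real, norm_inv, norm_pow] at h'
  refine (le_abs_self _).trans (h'.le.trans ?_)
  calc (‖∏' i : ℕ, (1 - (x : ℂ) ^ (i + 1))‖ ^ 24)⁻¹ ≤ ((498 / 499 : ℝ) ^ 24)⁻¹ := by gcongr
    _ ≤ 2 := by norm_num

lemma regularPart_le_of_one_le {t : ℝ} (ht : 1 ≤ t) :
    regularPart (exp (-(2 * π * t))) ≤ 2 * exp (2 * π) := by
  have h1 := exp_neg_two_pi_mul_lt_one (one_pos)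
  calc regularPart (exp (-(2 * π * t))) ≤ regularPart (exp (-(2 * π * 1))) :=
        regularPart_mono (Real.exp_pos _) (by gcongr) h1
    _ ≤ (exp (-(2 * π * 1)))⁻¹ * realGen (exp (-(2 * π * 1))) :=
        regularPart_le (Real.exp_pos _) h1
    _ ≤ (exp (-(2 * π * 1)))⁻¹ * 2 := by gcongr; exact realGen_le_two le_rfl
    _ = 2 * exp (2 * π) := by rw [← Real.exp_neg]; ring_nf

lemma regularPart_le_of_le_one {t : ℝ} (ht : 0 < t) (ht1 : t ≤ 1) :
    regularPart (exp (-(2 * π * t))) ≤ 2 * t ^ 12 * exp (2 * π / t) := by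
  have h1 := exp_neg_two_pi_mul_lt_one ht
  calc regularPart (exp (-(2 * π * t)))
      ≤ (exp (-(2 * π * t)))⁻¹ * realGen (exp (-(2 * π * t))) :=
        regularPart_le (Real.exp_pos _) h1
    _ = t ^ 12 * ((exp (-(2 * π * t⁻¹)))⁻¹ * realGen (exp (-(2 * π * t⁻¹)))) :=
        realGen_modular ht
    _ ≤ t ^ 12 * ((exp (-(2 * π * t⁻¹)))⁻¹ * 2) := by
        gcongr; exact realGen_le_two ((one_le_inv₀ ht).2 ht1)
    _ = 2 * t ^ 12 * exp (2 * π / t) := by rw [← Real.exp_neg]; ring_nf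

end PartitionSeries

namespace PartitionSeries

open Complex (I)

lemma integral_nome_zpow (y : ℝ) {k : ℤ} (hk : k ≠ 0) :
    ∫ x in (-(1 / 2) : ℝ)..1 / 2, nome (x + y * I) ^ k = 0 := by
  have hc : (2 * π * I * k : ℂ) ≠ 0 := by
    simp [Real.pi_ne_zero, hk]
  have h : ∀ x : ℝ, nome (x + y * I) ^ k = nome (y * I) ^ k * Complex.exp (2 * π * I * k * x) := by
    intro x
    rw [nome, nome, ← Complex.exp_int_mul, ← Complex.exp_int_mul, ← Complex.exp_add]
    congr 1
    ring
  simp_rw [h]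
  rw [intervalIntegral.integral_const_mul, integral_exp_mul_complex hc]
  have hper : Complex.exp (2 * π * I * k * (1 / 2 : ℝ)) =
      Complex.exp (2 * π * I * k * (-(1 / 2) : ℝ)) := by
    rw [Complex.exp_eq_exp_iff_exists_int]
    exact ⟨k, by push_cast; ring⟩
  rw [hper, sub_self, zero_div, mul_zero]

lemma continuous_nome : Continuous nome := by unfold nome; fun_prop

/-- The coefficients of the reciprocal discriminant as Fourier integrals. -/
lemma integral_invDisc (n : ℕ) {y : ℝ} (hy : 0 < y) :
    ∫ x in (-(1 / 2) : ℝ)..1 / 2,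
      invDisc (x + y * I) * Complex.exp (-(2 * π * I * n * (x + y * I))) =
      multiCount (n + 1) := by
  have him : ∀ x : ℝ, ((x : ℂ) + y * I).im = y := by simp
  have hterm : ∀ (m : ℕ) (x : ℝ), nome (x + y * I) ^ ((m : ℤ) - (n + 1 : ℕ)) =
      (nome (x + y * I))⁻¹ * nome (x + y * I) ^ m *
        Complex.exp (-(2 * π * I * n * (x + y * I))) := by
    intro m x
    have h0 := nome_ne_zero (x + y * I)
    have h1 : Complex.exp (-(2 * π * I * n * (x + y * I))) = (nome (x + y * I) ^ n)⁻¹ := by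
      rw [nome, ← Complex.exp_nat_mul, ← Complex.exp_neg]
      congr 1
      ring
    rw [h1, zpow_sub₀ h0, zpow_natCast, zpow_natCast, pow_succ]
    field_simp
  have hr1 := exp_neg_two_pi_mul_lt_one hy
  have hsum : HasSum (fun m : ℕ ↦ ∫ x in (-(1 / 2) : ℝ)..1 / 2,
      (multiCount m : ℂ) * nome (x + y * I) ^ ((m : ℤ) - (n + 1 : ℕ)))
      (∫ x in (-(1 / 2) : ℝ)..1 / 2,
        invDisc (x + y * I) * Complex.exp (-(2 * π * I * n * (x + y * I)))) := by
    refine intervalIntegral.hasSum_integral_of_dominated_convergence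
      (fun m _ ↦ (multiCount m : ℝ) * exp (-(2 * π * y)) ^ m *
        (exp (-(2 * π * y)) ^ (n + 1))⁻¹) (fun m ↦ ?_) (fun m ↦ ?_) ?_ ?_ ?_
    · refine Continuous.aestronglyMeasurable ?_
      refine continuous_const.mul (Continuous.zpow₀ ?_ _ fun x ↦ Or.inl (nome_ne_zero _))
      exact continuous_nome.comp (by fun_prop)
    · refine .of_forall fun x _ ↦ le_of_eq ?_
      rw [zpow_sub₀ (nome_ne_zero _), norm_mul, norm_div, zpow_natCast, zpow_natCast, norm_pow,
        norm_pow, norm_nome, him, Complex.norm_natCast]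
      ring
    · exact .of_forall fun x _ ↦ (summable_realGen (Real.exp_pos _).le hr1).mul_right _
    · exact intervalIntegrable_const
    · refine .of_forall fun x _ ↦ ?_
      have hS : Summable fun m ↦ (multiCount m : ℂ) * nome (x + y * I) ^ m := by
        refine .of_norm ?_
        simpa using summable_multiCount (norm_nome_lt_one (τ := x + y * I) (by rwa [him]))
      have := (hS.hasSum.mul_left (nome (x + y * I))⁻¹).mul_right
        (Complex.exp (-(2 * π * I * n * (x + y * I))))
      rw [invDisc]
      refine this.congr_fun fun m ↦ ?_
      rw [hterm]
      ring
  refine hsum.unique ?_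
  convert hasSum_single (n + 1) ?_ using 1
  · simp; norm_num
  · intro m hm
    rw [intervalIntegral.integral_const_mul, integral_nome_zpow, mul_zero]
    omega

end PartitionSeries

namespace PartitionSeries

open Complex (I)

/-- The contribution of the polar part at the cusp `0` to the Fourier integral. -/
noncomputable def polarKernel (n : ℝ) (τ : ℂ) : ℂ :=
  τ ^ 12 * Complex.exp (2 * π * I / τ) * Complex.exp (-(2 * π * I * n * τ))

lemma norm_exp_neg_two_pi (n : ℝ) (τ : ℂ) :
    ‖Complex.exp (-(2 * π * I * n * τ))‖ = exp (2 * π * n * τ.im) := by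
  rw [Complex.norm_exp]
  simp [mul_assoc]

lemma norm_exp_two_pi_div (τ : ℂ) :
    ‖Complex.exp (2 * π * I / τ)‖ = exp (2 * π * (τ.im / Complex.normSq τ)) := by
  rw [Complex.norm_exp, div_eq_mul_inv]
  simp [mul_assoc, neg_div]

lemma im_neg_one_div (τ : ℂ) : (-1 / τ).im = τ.im / Complex.normSq τ := by
  rw [neg_div, one_div, Complex.neg_im, Complex.inv_im, neg_div, neg_neg]

lemma norm_pow_twelve (τ : ℂ) : ‖τ‖ ^ 12 = Complex.normSq τ ^ 6 := by
  rw [Complex.normSq_eq_norm_sq, ← pow_mul]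

lemma norm_invDisc_sub_polarKernel_le {s x : ℝ} (hs : 8 ≤ s) (hx : |x| ≤ 1 / 2) :
    ‖invDisc (x + (s⁻¹ : ℝ) * I) *
        Complex.exp (-(2 * π * I * (s ^ 2 : ℝ) * (x + (s⁻¹ : ℝ) * I))) -
      polarKernel (s ^ 2) (x + (s⁻¹ : ℝ) * I)‖ ≤ 2 * exp (5 / 2 * π * s + 2 * π / s) := by
  have hs0 : 0 < s := by linarith
  have hy : 0 < s⁻¹ := by positivity
  set τ : ℂ := x + (s⁻¹ : ℝ) * I with hτ
  have him : τ.im = s⁻¹ := by simp [hτ]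
  have hτpos : 0 < τ.im := by rwa [him]
  set N := Complex.normSq τ with hN
  have hNeq : N = x ^ 2 + s⁻¹ ^ 2 := by simp [hN, hτ, Complex.normSq_apply]; ring
  have hx2 : x ^ 2 ≤ 1 / 4 := by nlinarith [abs_le.1 hx]
  have hyle : s⁻¹ ≤ 1 / 8 := by
    rw [one_div]; gcongr
  have hN0 : 0 < N := by rw [hNeq]; positivity
  have hN1 : N ≤ 1 := by rw [hNeq]; nlinarith
  have hπ := Real.pi_pos
  have hpolar : polarKernel (s ^ 2) τ = τ ^ 12 * (nome (-1 / τ))⁻¹ *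
      Complex.exp (-(2 * π * I * (s ^ 2 : ℝ) * τ)) := by
    rw [polarKernel, nome, ← Complex.exp_neg]
    congr 3
    ring
  have hkey : ‖invDisc τ * Complex.exp (-(2 * π * I * (s ^ 2 : ℝ) * τ)) -
      polarKernel (s ^ 2) τ‖ ≤ N ^ 6 * regularPart (exp (-(2 * π * (s⁻¹ / N)))) *
        exp (2 * π * s) := by
    rw [hpolar, invDisc_modular hτpos, ← sub_mul, ← mul_sub, norm_mul, norm_mul, norm_pow,
      norm_pow_twelve, norm_exp_neg_two_pi, him,
      show 2 * π * s ^ 2 * s⁻¹ = 2 * π * s by field_simp]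
    have := norm_invDisc_sub_inv_le (im_neg_inv_pos hτpos)
    rw [im_neg_one_div, him] at this
    gcongr
  refine hkey.trans ?_
  have hV : 0 < s⁻¹ / N := by positivity
  rcases le_total 1 (s⁻¹ / N) with h1 | h1
  · have hR := regularPart_le_of_one_le h1
    calc N ^ 6 * regularPart (exp (-(2 * π * (s⁻¹ / N)))) * exp (2 * π * s)
        ≤ 1 * (2 * exp (2 * π)) * exp (2 * π * s) := by
          gcongr
          · exact tsum_nonneg fun m ↦ by positivity
          · exact pow_le_one₀ hN0.le hN1
      _ = 2 * exp (2 * π + 2 * π * s) := by rw [Real.exp_add]; ring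
      _ ≤ 2 * exp (5 / 2 * π * s + 2 * π / s) := by
          refine mul_le_mul_of_nonneg_left (Real.exp_le_exp.2 ?_) two_pos.le
          have : 0 < 2 * π / s := by positivity
          nlinarith
  · have hR := regularPart_le_of_le_one hV h1
    have hfac : N ^ 6 * (s⁻¹ / N) ^ 12 ≤ 1 := by
      have h2 : N * (s⁻¹ / N) ^ 2 ≤ 1 := by
        rw [div_pow, mul_div_assoc', div_le_one (by positivity), pow_two N]
        gcongr
        rw [hNeq]; nlinarith
      calc N ^ 6 * (s⁻¹ / N) ^ 12 = (N * (s⁻¹ / N) ^ 2) ^ 6 := by ring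
        _ ≤ 1 := pow_le_one₀ (by positivity) h2
    have hexp : 2 * π / (s⁻¹ / N) ≤ π * s / 2 + 2 * π / s := by
      have : 2 * π / (s⁻¹ / N) = 2 * π * s * N := by field_simp
      rw [this, hNeq]
      have h3 : 2 * π * s * (1 / 4 + s⁻¹ ^ 2) = π * s / 2 + 2 * π / s := by field_simp; ring
      rw [← h3]
      gcongr
    calc N ^ 6 * regularPart (exp (-(2 * π * (s⁻¹ / N)))) * exp (2 * π * s)
        ≤ N ^ 6 * (2 * (s⁻¹ / N) ^ 12 * exp (2 * π / (s⁻¹ / N))) * exp (2 * π * s) := by gcongr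
      _ = 2 * (N ^ 6 * (s⁻¹ / N) ^ 12) * (exp (2 * π / (s⁻¹ / N)) * exp (2 * π * s)) := by ring
      _ ≤ 2 * 1 * (exp (π * s / 2 + 2 * π / s) * exp (2 * π * s)) := by gcongr
      _ = 2 * exp (5 / 2 * π * s + 2 * π / s) := by rw [← Real.exp_add]; ring_nf

lemma norm_polarKernel_le {s : ℝ} (hs : 8 ≤ s) {τ : ℂ} (hτ1 : Complex.normSq τ ≤ 1)
    (him : τ.im ≤ s⁻¹) (hτ : 1 / 4 ≤ Complex.normSq τ) :
    ‖polarKernel (s ^ 2) τ‖ ≤ exp (2 * π * s + 8 * π / s) := by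
  have hπ := Real.pi_pos
  have hs0 : 0 < s := by linarith
  have hN0 : 0 < Complex.normSq τ := by linarith
  have h1 : τ.im / Complex.normSq τ ≤ 4 * s⁻¹ := by
    rw [div_le_iff₀ hN0]
    have : 0 < s⁻¹ := by positivity
    nlinarith
  rw [polarKernel, norm_mul, norm_mul, norm_pow, norm_pow_twelve, norm_exp_neg_two_pi,
    norm_exp_two_pi_div]
  calc Complex.normSq τ ^ 6 * exp (2 * π * (τ.im / Complex.normSq τ)) *
        exp (2 * π * s ^ 2 * τ.im)
      ≤ 1 * exp (2 * π * (4 * s⁻¹)) * exp (2 * π * s ^ 2 * s⁻¹) := by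
        gcongr
        exact pow_le_one₀ hN0.le hτ1
    _ = exp (2 * π * s + 8 * π / s) := by
        rw [one_mul, ← Real.exp_add]
        congr 1
        field_simp
        ring

end PartitionSeries

namespace PartitionSeries

open Complex (I)

/-- The clockwise integral of `f` over the boundary of the rectangle
`[-1/2, 1/2] × [-1/2, y]`. -/
noncomputable def rectIntegral (y : ℝ) (f : ℂ → ℂ) : ℂ :=
  (∫ x in (-(1 / 2) : ℝ)..1 / 2, f (x + y * I)) -
    (∫ x in (-(1 / 2) : ℝ)..1 / 2, f (x + (-(1 / 2) : ℝ) * I)) -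
    I * (∫ v in (-(1 / 2) : ℝ)..y, f ((1 / 2 : ℝ) + v * I)) +
    I * (∫ v in (-(1 / 2) : ℝ)..y, f ((-(1 / 2) : ℝ) + v * I))

lemma add_mul_I_ne_zero {a b : ℝ} (h : a ≠ 0 ∨ b ≠ 0) : (a : ℂ) + b * I ≠ 0 := by
  intro h0
  have h1 := congrArg Complex.re h0
  have h2 := congrArg Complex.im h0
  simp at h1 h2
  tauto

lemma integral_zpow_horizontal {m : ℤ} (hm : m ≠ -1) {a b y : ℝ} (hy : y ≠ 0) :
    ∫ x in a..b, ((x : ℂ) + y * I) ^ m =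
      (b + y * I) ^ (m + 1) / (m + 1) - (a + y * I) ^ (m + 1) / (m + 1) := by
  have hm' : (m : ℂ) + 1 ≠ 0 := by exact_mod_cast fun h ↦ hm (by omega)
  have h0 : ∀ x : ℝ, (x : ℂ) + y * I ≠ 0 := fun x ↦ add_mul_I_ne_zero (Or.inr hy)
  refine intervalIntegral.integral_eq_sub_of_hasDerivAt
    (f := fun x : ℝ ↦ ((x : ℂ) + y * I) ^ (m + 1) / (m + 1)) (fun x _ ↦ ?_) ?_
  · have h1 : HasDerivAt (fun x : ℝ ↦ (x : ℂ) + y * I) 1 x :=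
      (Complex.ofRealCLM.hasDerivAt (x := x)).add_const _
    have h2 := ((hasDerivAt_zpow (m + 1) _ (Or.inl (h0 x))).comp x h1).div_const ((m : ℂ) + 1)
    convert! h2 using 1
    push_cast
    field_simp
    simp
  · refine ContinuousOn.intervalIntegrable ?_
    exact ContinuousOn.zpow₀ (by fun_prop) _ fun x _ ↦ Or.inl (h0 x)

lemma integral_zpow_vertical {m : ℤ} (hm : m ≠ -1) {a b x : ℝ} (hx : x ≠ 0) :
    I * ∫ v in a..b, ((x : ℂ) + v * I) ^ m =
      (x + b * I) ^ (m + 1) / (m + 1) - (x + a * I) ^ (m + 1) / (m + 1) := by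
  have hm' : (m : ℂ) + 1 ≠ 0 := by exact_mod_cast fun h ↦ hm (by omega)
  have h0 : ∀ v : ℝ, (x : ℂ) + v * I ≠ 0 := fun v ↦ add_mul_I_ne_zero (Or.inl hx)
  rw [← intervalIntegral.integral_const_mul]
  refine intervalIntegral.integral_eq_sub_of_hasDerivAt
    (f := fun v : ℝ ↦ ((x : ℂ) + v * I) ^ (m + 1) / (m + 1)) (fun v _ ↦ ?_) ?_
  · have h1 : HasDerivAt (fun v : ℝ ↦ (x : ℂ) + v * I) (1 * I) v :=
      ((Complex.ofRealCLM.hasDerivAt (x := v)).mul_const I).const_add _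
    have h2 := ((hasDerivAt_zpow (m + 1) _ (Or.inl (h0 v))).comp v h1).div_const ((m : ℂ) + 1)
    convert! h2 using 1
    push_cast
    field_simp
    simp
  · refine ContinuousOn.intervalIntegrable ?_
    exact continuousOn_const.mul
      (ContinuousOn.zpow₀ (by fun_prop) _ fun x _ ↦ Or.inl (h0 x))

lemma rectIntegral_zpow_of_ne {y : ℝ} (hy : 0 < y) {m : ℤ} (hm : m ≠ -1) :
    rectIntegral y (fun z ↦ z ^ m) = 0 := by
  rw [rectIntegral, integral_zpow_horizontal hm hy.ne', integral_zpow_horizontal hm (by norm_num),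
    integral_zpow_vertical hm (by norm_num), integral_zpow_vertical hm (by norm_num)]
  ring

lemma integral_inv_horizontal {a b y : ℝ} {c : ℂ}
    (hc : ∀ x : ℝ, c * (x + y * I) ∈ Complex.slitPlane) :
    ∫ x in a..b, ((x : ℂ) + y * I)⁻¹ =
      Complex.log (c * (b + y * I)) - Complex.log (c * (a + y * I)) := by
  have h0 : ∀ x : ℝ, c ≠ 0 ∧ (x : ℂ) + y * I ≠ 0 := fun x ↦
    mul_ne_zero_iff.1 (Complex.slitPlane_ne_zero (hc x))
  refine intervalIntegral.integral_eq_sub_of_hasDerivAt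
    (f := fun x : ℝ ↦ Complex.log (c * ((x : ℂ) + y * I))) (fun x _ ↦ ?_) ?_
  · have h1 : HasDerivAt (fun x : ℝ ↦ c * ((x : ℂ) + y * I)) (c * 1) x :=
      ((Complex.ofRealCLM.hasDerivAt (x := x)).add_const _).const_mul c
    convert! h1.clog_real (hc x) using 1
    field_simp [(h0 x).1, (h0 x).2]
  · refine ContinuousOn.intervalIntegrable ?_
    exact ContinuousOn.inv₀ (by fun_prop) fun x _ ↦ (h0 x).2

lemma integral_inv_vertical {a b x : ℝ} {c : ℂ}
    (hc : ∀ v : ℝ, c * (x + v * I) ∈ Complex.slitPlane) :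
    I * ∫ v in a..b, ((x : ℂ) + v * I)⁻¹ =
      Complex.log (c * (x + b * I)) - Complex.log (c * (x + a * I)) := by
  have h0 : ∀ v : ℝ, c ≠ 0 ∧ (x : ℂ) + v * I ≠ 0 := fun v ↦
    mul_ne_zero_iff.1 (Complex.slitPlane_ne_zero (hc v))
  rw [← intervalIntegral.integral_const_mul]
  refine intervalIntegral.integral_eq_sub_of_hasDerivAt
    (f := fun v : ℝ ↦ Complex.log (c * ((x : ℂ) + v * I))) (fun v _ ↦ ?_) ?_
  · have h1 : HasDerivAt (fun v : ℝ ↦ c * ((x : ℂ) + v * I)) (c * (1 * I)) v :=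
      (((Complex.ofRealCLM.hasDerivAt (x := v)).mul_const I).const_add _).const_mul c
    convert! h1.clog_real (hc v) using 1
    field_simp [(h0 v).1, (h0 v).2]
  · refine ContinuousOn.intervalIntegrable ?_
    exact continuousOn_const.mul (ContinuousOn.inv₀ (by fun_prop) fun x _ ↦ (h0 x).2)

lemma log_I_mul {w : ℂ} (hw : 0 < w.re) : Complex.log (I * w) = π / 2 * I + Complex.log w := by
  have h := abs_lt.1 (Complex.abs_arg_lt_pi_div_two_iff.2 (Or.inl hw))
  have hw0 : w ≠ 0 := fun h ↦ by simp_all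
  have hπ := Real.pi_pos
  rw [Complex.log_mul Complex.I_ne_zero hw0, Complex.log_I]
  rw [Complex.arg_I]
  constructor <;> linarith

lemma log_neg_I_mul {w : ℂ} (hw : 0 < w.re) :
    Complex.log (-I * w) = -(π / 2 * I) + Complex.log w := by
  have h := abs_lt.1 (Complex.abs_arg_lt_pi_div_two_iff.2 (Or.inl hw))
  have hw0 : w ≠ 0 := fun h ↦ by simp_all
  have hπ := Real.pi_pos
  rw [Complex.log_mul (neg_ne_zero.2 Complex.I_ne_zero) hw0, Complex.log_neg_I]
  · ring
  rw [Complex.arg_neg_I]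
  constructor <;> linarith

lemma rectIntegral_inv {y : ℝ} (hy : 0 < y) :
    rectIntegral y (fun z ↦ z ^ (-1 : ℤ)) = -(2 * π * I) := by
  simp only [zpow_neg_one]
  rw [rectIntegral, integral_inv_horizontal (c := -I) (fun x ↦ Or.inl (by simpa)),
    integral_inv_horizontal (c := I) (fun x ↦ Or.inl (by norm_num)),
    integral_inv_vertical (c := 1) (fun v ↦ Or.inl (by norm_num)),
    integral_inv_vertical (c := -1) (fun v ↦ Or.inl (by norm_num))]
  have h1 := log_neg_I_mul (w := ((1 / 2 : ℝ) : ℂ) + y * I) (by norm_num)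
  have h2 := log_I_mul (w := -1 * (((-(1 / 2) : ℝ) : ℂ) + y * I)) (by norm_num)
  have h3 := log_I_mul (w := 1 * (((1 / 2 : ℝ) : ℂ) + (-(1 / 2) : ℝ) * I)) (by norm_num)
  have h4 := log_neg_I_mul (w := -1 * (((-(1 / 2) : ℝ) : ℂ) + (-(1 / 2) : ℝ) * I)) (by norm_num)
  rw [show I * (-1 * (((-(1 / 2) : ℝ) : ℂ) + y * I)) = -I * (((-(1 / 2) : ℝ) : ℂ) + y * I) by
    ring] at h2
  rw [one_mul] at h3
  rw [show -I * (-1 * (((-(1 / 2) : ℝ) : ℂ) + (-(1 / 2) : ℝ) * I)) =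
    I * (((-(1 / 2) : ℝ) : ℂ) + (-(1 / 2) : ℝ) * I) by ring] at h4
  rw [h1, h2, h3, h4, one_mul, one_mul]
  ring

end PartitionSeries

namespace PartitionSeries

open Complex (I)

/-- The coefficients of the Laurent expansion of the product of exponentials in `polarKernel`. -/
noncomputable def polarCoeff (n : ℝ) (p : ℕ × ℕ) : ℂ :=
  (2 * π * I) ^ p.1 / p.1.factorial * ((-(2 * π * I * n)) ^ p.2 / p.2.factorial)

lemma hasSum_exp (z : ℂ) : HasSum (fun k : ℕ ↦ z ^ k / k.factorial) (Complex.exp z) := by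
  rw [Complex.exp_eq_exp_ℂ]
  exact NormedSpace.expSeries_div_hasSum_exp z

lemma summable_norm_exp (z : ℂ) : Summable fun k : ℕ ↦ ‖z ^ k / k.factorial‖ := by
  simpa using Real.summable_pow_div_factorial ‖z‖

lemma hasSum_polarKernel (n : ℝ) {τ : ℂ} (hτ : τ ≠ 0) :
    HasSum (fun p : ℕ × ℕ ↦ polarCoeff n p * τ ^ (12 - (p.1 : ℤ) + p.2)) (polarKernel n τ) := by
  have hS := summable_mul_of_summable_norm (summable_norm_exp (2 * π * I / τ))
    (summable_norm_exp (-(2 * π * I * n * τ)))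
  have h := ((hasSum_exp (2 * π * I / τ)).mul (hasSum_exp (-(2 * π * I * n * τ))) hS).mul_left
    (τ ^ 12)
  rw [polarKernel, mul_assoc]
  refine h.congr_fun fun p ↦ ?_
  rw [polarCoeff, zpow_add₀ hτ, zpow_sub₀ hτ, zpow_natCast, zpow_natCast,
    show -(2 * π * I * n * τ) = -(2 * π * I * n) * τ by ring, mul_pow, div_pow]
  have : τ ^ (12 : ℤ) = τ ^ 12 := by norm_cast
  rw [this]
  ring

lemma hasSum_integral_polarKernel (n : ℝ) {γ : ℝ → ℂ} (hγ : Continuous γ) {a b δ : ℝ}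
    (hab : a ≤ b) (hδ : 0 < δ) (hlow : ∀ t ∈ Set.Icc a b, δ ≤ ‖γ t‖)
    (hup : ∀ t ∈ Set.Icc a b, ‖γ t‖ ≤ 1) :
    HasSum (fun p : ℕ × ℕ ↦ ∫ t in a..b, polarCoeff n p * γ t ^ (12 - (p.1 : ℤ) + p.2))
      (∫ t in a..b, polarKernel n (γ t)) := by
  have hmem : ∀ t ∈ Set.uIoc a b, t ∈ Set.Icc a b := fun t ht ↦ by
    rw [Set.uIoc_of_le hab] at ht
    exact Set.Ioc_subset_Icc_self ht
  refine intervalIntegral.hasSum_integral_of_dominated_convergence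
    (fun p _ ↦ (2 * π / δ) ^ p.1 / p.1.factorial * ((2 * π * |n|) ^ p.2 / p.2.factorial))
    (fun p ↦ ?_) (fun p ↦ ?_) ?_ ?_ ?_
  · have : Measurable fun t ↦ γ t ^ (12 - (p.1 : ℤ) + p.2) :=
      hγ.measurable.pow_const _
    exact (this.const_mul _).aestronglyMeasurable
  · refine .of_forall fun t ht ↦ ?_
    have h1 := hlow t (hmem t ht)
    have h2 := hup t (hmem t ht)
    have h0 : 0 < ‖γ t‖ := hδ.trans_le h1
    have hpow : ‖γ t‖ ^ (12 - (p.1 : ℤ) + p.2) ≤ (δ ^ p.1)⁻¹ := by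
      rw [zpow_add₀ h0.ne', zpow_sub₀ h0.ne', zpow_natCast, zpow_natCast]
      calc ‖γ t‖ ^ (12 : ℤ) / ‖γ t‖ ^ p.1 * ‖γ t‖ ^ p.2 ≤ 1 / δ ^ p.1 * 1 := by
            gcongr
            · exact pow_le_one₀ h0.le h2
            · exact pow_le_one₀ h0.le h2
        _ = (δ ^ p.1)⁻¹ := by ring
    have hc : ‖polarCoeff n p‖ =
        (2 * π) ^ p.1 / p.1.factorial * ((2 * π * |n|) ^ p.2 / p.2.factorial) := by
      simp [polarCoeff, abs_of_pos Real.pi_pos]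
    rw [norm_mul, norm_zpow, hc]
    calc _ ≤ (2 * π) ^ p.1 / p.1.factorial * ((2 * π * |n|) ^ p.2 / p.2.factorial) *
          (δ ^ p.1)⁻¹ := by gcongr
      _ = _ := by rw [div_pow]; ring
  · refine .of_forall fun t _ ↦ ?_
    refine (Real.summable_pow_div_factorial _).mul_of_nonneg
      (Real.summable_pow_div_factorial _) (fun k ↦ ?_) (fun k ↦ ?_)
    · simp only [Pi.zero_apply]; positivity
    · simp only [Pi.zero_apply]; positivity
  · exact intervalIntegrable_const
  · refine .of_forall fun t ht ↦ hasSum_polarKernel n ?_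
    exact norm_pos_iff.1 (hδ.trans_le (hlow t (hmem t ht)))

lemma norm_add_mul_I_bounds {a b δ : ℝ} (h1 : δ ^ 2 ≤ a ^ 2 + b ^ 2)
    (h2 : a ^ 2 + b ^ 2 ≤ 1) : δ ≤ ‖(a : ℂ) + b * I‖ ∧ ‖(a : ℂ) + b * I‖ ≤ 1 := by
  rw [Complex.norm_add_mul_I]
  exact ⟨Real.le_sqrt_of_sq_le h1, Real.sqrt_le_one.2 h2⟩

lemma hasSum_rectIntegral_polarKernel (n : ℝ) {y : ℝ} (hy : 0 < y) (hy1 : y ≤ 1 / 2) :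
    HasSum (fun p : ℕ × ℕ ↦ polarCoeff n p * rectIntegral y (fun z ↦ z ^ (12 - (p.1 : ℤ) + p.2)))
      (rectIntegral y (polarKernel n)) := by
  have hb : ∀ u v : ℝ, u ∈ Set.Icc (-(1 / 2)) (1 / 2) → v ∈ Set.Icc (-(1 / 2)) (1 / 2) →
      u ^ 2 + v ^ 2 ≤ 1 := fun u v hu hv ↦ by
    obtain ⟨h1, h2⟩ := hu
    obtain ⟨h3, h4⟩ := hv
    nlinarith
  have hsub : ∀ v ∈ Set.Icc (-(1 / 2)) y, v ∈ Set.Icc (-(1 / 2)) (1 / 2 : ℝ) :=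
    fun v hv ↦ ⟨hv.1, hv.2.trans hy1⟩
  have hl : (-(1 / 2) : ℝ) ∈ Set.Icc (-(1 / 2)) (1 / 2 : ℝ) := by norm_num
  have hr : (1 / 2 : ℝ) ∈ Set.Icc (-(1 / 2)) (1 / 2 : ℝ) := by norm_num
  have htop := hasSum_integral_polarKernel n (γ := fun x : ℝ ↦ (x : ℂ) + y * I) (by fun_prop)
    (a := -(1 / 2)) (b := 1 / 2) (by norm_num) hy
    (fun t ht ↦ (norm_add_mul_I_bounds (δ := y) (by nlinarith)
      (hb t y ht ⟨by linarith, hy1⟩)).1)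
    (fun t ht ↦ (norm_add_mul_I_bounds (δ := y) (by nlinarith)
      (hb t y ht ⟨by linarith, hy1⟩)).2)
  have hbot := hasSum_integral_polarKernel n
    (γ := fun x : ℝ ↦ (x : ℂ) + (-(1 / 2) : ℝ) * I) (by fun_prop)
    (a := -(1 / 2)) (b := 1 / 2) (by norm_num) (δ := 1 / 2) (by norm_num)
    (fun t ht ↦ (norm_add_mul_I_bounds (by nlinarith) (hb _ _ ht hl)).1)
    (fun t ht ↦ (norm_add_mul_I_bounds (δ := 1 / 2) (by nlinarith)
      (hb _ _ ht hl)).2)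
  have hright := hasSum_integral_polarKernel n
    (γ := fun v : ℝ ↦ ((1 / 2 : ℝ) : ℂ) + v * I) (by fun_prop)
    (a := -(1 / 2)) (b := y) (by linarith) (δ := 1 / 2) (by norm_num)
    (fun t ht ↦ (norm_add_mul_I_bounds (by nlinarith) (hb _ _ hr (hsub t ht))).1)
    (fun t ht ↦ (norm_add_mul_I_bounds (δ := 1 / 2) (by nlinarith)
      (hb _ _ hr (hsub t ht))).2)
  have hleft := hasSum_integral_polarKernel n
    (γ := fun v : ℝ ↦ ((-(1 / 2) : ℝ) : ℂ) + v * I) (by fun_prop)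
    (a := -(1 / 2)) (b := y) (by linarith) (δ := 1 / 2) (by norm_num)
    (fun t ht ↦ (norm_add_mul_I_bounds (by nlinarith) (hb _ _ hl (hsub t ht))).1)
    (fun t ht ↦ (norm_add_mul_I_bounds (δ := 1 / 2) (by nlinarith)
      (hb _ _ hl (hsub t ht))).2)
  have h := ((htop.sub hbot).sub (hright.mul_left I)).add (hleft.mul_left I)
  refine h.congr_fun fun p ↦ ?_
  simp only [intervalIntegral.integral_const_mul, rectIntegral]
  ring

lemma polarCoeff_mul (n : ℝ) (a : ℕ) :
    polarCoeff n (a + 13, a) * -(2 * π * I) =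
      ((4 * π ^ 2) ^ 7 * besselTerm (4 * π ^ 2 * n) a : ℝ) := by
  have hI : I ^ 12 = 1 := by rw [show 12 = 4 * 3 by norm_num, pow_mul, Complex.I_pow_four, one_pow]
  have h1 : (2 * π * I) ^ (a + 13) * (-(2 * π * I * n)) ^ a * -(2 * π * I) =
      ((4 * π ^ 2) ^ 7 * (4 * π ^ 2 * n) ^ a : ℂ) := by
    calc (2 * π * I) ^ (a + 13) * (-(2 * π * I * n)) ^ a * -(2 * π * I)
        = (2 * π * I * (-(2 * π * I * n))) ^ a * (-(I ^ 2)) * I ^ 12 * (2 * π) ^ 14 := by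
          rw [mul_pow (2 * π * I), pow_add]; ring
      _ = _ := by
          rw [hI, Complex.I_sq,
            show 2 * π * I * (-(2 * π * I * n)) = 4 * π ^ 2 * n * (-(I ^ 2)) by ring,
            Complex.I_sq]
          ring
  rw [polarCoeff, besselTerm]
  push_cast
  rw [← mul_div_assoc ((4 * π ^ 2 : ℂ) ^ 7), ← h1]
  field_simp

lemma rectIntegral_polarKernel {n : ℝ} (hn : 0 ≤ n) {y : ℝ} (hy : 0 < y) (hy1 : y ≤ 1 / 2) :
    rectIntegral y (polarKernel n) = mainTerm n := by
  have hinj : Function.Injective fun a : ℕ ↦ (a + 13, a) := fun a b h ↦ (Prod.ext_iff.1 h).2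
  have h := (hinj.hasSum_iff (f := fun p : ℕ × ℕ ↦ polarCoeff n p *
    rectIntegral y (fun z ↦ z ^ (12 - (p.1 : ℤ) + p.2))) (fun p hp ↦ by
      rw [rectIntegral_zpow_of_ne hy, mul_zero]
      intro h
      exact hp ⟨p.2, Prod.ext (by simp only; omega) rfl⟩)).2
    (hasSum_rectIntegral_polarKernel n hy hy1)
  have h' := ((summable_besselTerm (a := 4 * π ^ 2 * n) (by positivity)).hasSum.mul_left
    ((4 * π ^ 2) ^ 7))
  rw [← mainTerm] at h'
  refine h.unique ((Complex.hasSum_ofReal.2 h').congr_fun fun a ↦ ?_)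
  have he : (12 : ℤ) - ((a + 13 : ℕ) : ℤ) + a = -1 := by push_cast; ring
  simp only [Function.comp_apply, he]
  rw [rectIntegral_inv hy, polarCoeff_mul]

end PartitionSeries

namespace PartitionSeries

open Complex (I)

lemma factorial_le_of_factorial_le {C k : ℕ} (hk : 44 ≤ k)
    (h44 : 49 ^ 44 * (Nat.factorial 44 * (44 + 13).factorial) ≤
      C * (16 ^ 44 * (2 * 44).factorial)) :
    49 ^ k * (k.factorial * (k + 13).factorial) ≤ C * (16 ^ k * (2 * k).factorial) := by
  induction k, hk using Nat.le_induction with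
  | base => exact h44
  | succ k hk ih =>
    have h1 : 49 ^ (k + 1) * ((k + 1).factorial * (k + 1 + 13).factorial) =
        (k + 1) * (49 * (k + 14)) * (49 ^ k * (k.factorial * (k + 13).factorial)) := by
      rw [show k + 1 + 13 = (k + 13) + 1 by ring, Nat.factorial_succ, Nat.factorial_succ (k + 13)]
      ring
    have h2 : 16 ^ (k + 1) * (2 * (k + 1)).factorial =
        (k + 1) * (32 * (2 * k + 1)) * (16 ^ k * (2 * k).factorial) := by
      rw [show 2 * (k + 1) = 2 * k + 1 + 1 by ring, Nat.factorial_succ, Nat.factorial_succ]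
      ring
    have h3 : 49 * (k + 14) ≤ 32 * (2 * k + 1) := by omega
    rw [h1, h2, mul_left_comm C]
    exact Nat.mul_le_mul (Nat.mul_le_mul_left _ h3) ih

lemma factorial_comparison (k : ℕ) :
    49 ^ k * (k.factorial * (k + 13).factorial) ≤
      2 * 10 ^ 7 * 39 ^ 7 * (16 ^ k * (2 * k).factorial) := by
  have h : ∀ j < 45, 49 ^ j * (j.factorial * (j + 13).factorial) ≤
      2 * 10 ^ 7 * 39 ^ 7 * (16 ^ j * (2 * j).factorial) := by decide +kernel
  rcases lt_or_ge k 45 with hk | hk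
  · exact h k hk
  · exact factorial_le_of_factorial_le (by omega) (h 44 (by norm_num))

lemma exp_le_mainTerm (s : ℝ) :
    exp (7 / 2 * π * s) ≤ 4 * 10 ^ 7 * mainTerm (s ^ 2) := by
  have hπ := four_pi_sq_bounds.1
  have hcosh : exp (7 / 2 * π * s) ≤ 2 * cosh (7 / 2 * π * s) := by
    rw [Real.cosh_eq]
    linarith [Real.exp_pos (-(7 / 2 * π * s))]
  have hterm : ∀ k : ℕ, (7 / 2 * π * s) ^ (2 * k) / (2 * k).factorial ≤
      2 * 10 ^ 7 * (4 * π ^ 2) ^ 7 * besselTerm (4 * π ^ 2 * s ^ 2) k := by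
    intro k
    have h1 : (7 / 2 * π * s) ^ (2 * k) = 49 ^ k / 16 ^ k * (4 * π ^ 2 * s ^ 2) ^ k := by
      rw [pow_mul, ← div_pow, ← mul_pow]
      congr 1
      ring
    have h2 : (49 ^ k * (k.factorial * (k + 13).factorial) : ℝ) ≤
        2 * 10 ^ 7 * 39 ^ 7 * (16 ^ k * (2 * k).factorial) := by
      exact_mod_cast factorial_comparison k
    have h3 : (39 : ℝ) ^ 7 ≤ (4 * π ^ 2) ^ 7 := by gcongr; linarith
    have h4 : (49 ^ k / (16 ^ k * (2 * k).factorial) : ℝ) ≤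
        2 * 10 ^ 7 * (4 * π ^ 2) ^ 7 / (k.factorial * (k + 13).factorial) := by
      rw [div_le_div_iff₀ (by positivity) (by positivity)]
      refine h2.trans ?_
      gcongr
    calc (7 / 2 * π * s) ^ (2 * k) / (2 * k).factorial
        = 49 ^ k / (16 ^ k * (2 * k).factorial) * (4 * π ^ 2 * s ^ 2) ^ k := by
          rw [h1]; field_simp
      _ ≤ 2 * 10 ^ 7 * (4 * π ^ 2) ^ 7 / (k.factorial * (k + 13).factorial) *
          (4 * π ^ 2 * s ^ 2) ^ k := by gcongr
      _ = _ := by rw [besselTerm]; ring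
  have hB := (summable_besselTerm (a := 4 * π ^ 2 * s ^ 2) (by positivity)).hasSum.mul_left
    (2 * 10 ^ 7 * (4 * π ^ 2) ^ 7)
  have := hasSum_le hterm (Real.hasSum_cosh (7 / 2 * π * s)) hB
  rw [mul_assoc (2 * 10 ^ 7), ← mainTerm] at this
  linarith

lemma error_lt_mainTerm {s : ℝ} (hs : 8 ≤ s) :
    2 * exp (5 / 2 * π * s + 2 * π / s) + 3 * exp (2 * π * s + 8 * π / s) <
      mainTerm (s ^ 2) / 12 := by
  have hπ := Real.pi_gt_d2
  have hπ' := Real.pi_lt_d2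
  have hs0 : 0 < s := by linarith
  have h1 : exp (5 / 2 * π * s + 2 * π / s) ≤ 3 * exp (5 / 2 * π * s) := by
    have h : 2 * π / s ≤ 1 := by rw [div_le_one hs0]; linarith
    calc exp (5 / 2 * π * s + 2 * π / s) ≤ exp (5 / 2 * π * s + 1) := by gcongr
      _ = exp 1 * exp (5 / 2 * π * s) := by rw [add_comm, Real.exp_add]
      _ ≤ 3 * exp (5 / 2 * π * s) := by gcongr; linarith [Real.exp_one_lt_d9]
  have h2 : exp (2 * π * s + 8 * π / s) ≤ exp (5 / 2 * π * s) := by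
    have h : 8 * π / s ≤ π := by rw [div_le_iff₀ hs0]; nlinarith
    rw [Real.exp_le_exp]
    nlinarith
  have h3 : (6 * 10 ^ 9 : ℝ) ≤ exp (π * s) := by
    calc (6 * 10 ^ 9 : ℝ) ≤ 2.7 ^ 25 := by norm_num
      _ ≤ exp 1 ^ 25 := by gcongr; linarith [Real.exp_one_gt_d9]
      _ = exp 25 := by rw [← Real.exp_nat_mul]; norm_num
      _ ≤ exp (π * s) := by rw [Real.exp_le_exp]; nlinarith
  have h4 := exp_le_mainTerm s
  rw [show 7 / 2 * π * s = π * s + 5 / 2 * π * s by ring, Real.exp_add] at h4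
  nlinarith [Real.exp_pos (5 / 2 * π * s)]

lemma norm_integral_polarKernel_sub_le {s : ℝ} (hs : 8 ≤ s) :
    ‖(∫ x in (-(1 / 2) : ℝ)..1 / 2, polarKernel (s ^ 2) (x + (s⁻¹ : ℝ) * I)) -
      mainTerm (s ^ 2)‖ ≤ 3 * exp (2 * π * s + 8 * π / s) := by
  have hs0 : 0 < s := by linarith
  have hy : 0 < s⁻¹ := by positivity
  have hyle : s⁻¹ ≤ 1 / 8 := by rw [one_div]; gcongr
  have hsq : ∀ a b : ℝ, Complex.normSq (a + b * I) = a ^ 2 + b ^ 2 := fun a b ↦ by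
    simp [Complex.normSq_apply]; ring
  rw [← rectIntegral_polarKernel (sq_nonneg s) hy (by linarith), rectIntegral]
  set E := exp (2 * π * s + 8 * π / s)
  have hE : 0 < E := Real.exp_pos _
  have hpoint : ∀ a b : ℝ, a ^ 2 ≤ 1 / 4 → b ^ 2 ≤ 1 / 4 → b ≤ s⁻¹ → 1 / 4 ≤ a ^ 2 + b ^ 2 →
      ‖polarKernel (s ^ 2) (a + b * I)‖ ≤ E := by
    intro a b ha hb hbs hab
    refine norm_polarKernel_le hs ?_ (by simpa) ?_ <;> rw [hsq] <;> linarith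
  have hbot : ‖∫ x in (-(1 / 2) : ℝ)..1 / 2, polarKernel (s ^ 2) (x + (-(1 / 2) : ℝ) * I)‖ ≤ E := by
    refine (intervalIntegral.norm_integral_le_of_norm_le_const (C := E) fun x hx ↦ ?_).trans ?_
    · rw [Set.uIoc_of_le (by norm_num)] at hx
      exact hpoint _ _ (by nlinarith [hx.1, hx.2]) (by norm_num) (by linarith) (by nlinarith)
    · norm_num
  have hside : ∀ a : ℝ, a ^ 2 = 1 / 4 →
      ‖∫ v in (-(1 / 2) : ℝ)..s⁻¹, polarKernel (s ^ 2) (a + v * I)‖ ≤ E := by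
    intro a ha
    refine (intervalIntegral.norm_integral_le_of_norm_le_const (C := E) fun v hv ↦ ?_).trans ?_
    · rw [Set.uIoc_of_le (by linarith)] at hv
      exact hpoint _ _ (by linarith) (by nlinarith [hv.1, hv.2]) hv.2 (by nlinarith)
    · rw [abs_of_pos (by linarith)]
      nlinarith
  have hright := hside (1 / 2) (by norm_num)
  have hleft := hside (-(1 / 2)) (by norm_num)
  generalize (∫ x in (-(1 / 2) : ℝ)..1 / 2, polarKernel (s ^ 2) (x + (s⁻¹ : ℝ) * I)) = T
  generalize (∫ x in (-(1 / 2) : ℝ)..1 / 2, polarKernel (s ^ 2) (x + (-(1 / 2) : ℝ) * I)) = B at *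
  generalize (∫ v in (-(1 / 2) : ℝ)..s⁻¹, polarKernel (s ^ 2) ((1 / 2 : ℝ) + v * I)) = R at *
  generalize (∫ v in (-(1 / 2) : ℝ)..s⁻¹, polarKernel (s ^ 2) ((-(1 / 2) : ℝ) + v * I)) = L at *
  calc ‖T - (T - B - I * R + I * L)‖ = ‖B + I * R - I * L‖ := by congr 1; ring
    _ ≤ ‖B‖ + ‖I * R‖ + ‖I * L‖ := (norm_sub_le _ _).trans (by gcongr; exact norm_add_le _ _)
    _ ≤ 3 * E := by simp only [norm_mul, Complex.norm_I, one_mul]; linarith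

lemma continuous_invDisc_horizontal {y : ℝ} (hy : 0 < y) :
    Continuous fun x : ℝ ↦ invDisc (x + y * I) := by
  have him : ∀ x : ℝ, 0 < ((x : ℂ) + y * I).im := by simpa using hy
  have h : (fun x : ℝ ↦ invDisc (x + y * I)) =
      fun x : ℝ ↦ (ModularForm.eta (x + y * I) ^ 24)⁻¹ := by
    ext x; exact invDisc_eq (him x)
  rw [h, continuous_iff_continuousAt]
  intro x
  have h1 : ContinuousAt ModularForm.eta ((x : ℂ) + y * I) :=
    (ModularForm.differentiableAt_eta_of_mem_upperHalfPlaneSet (him x)).continuousAt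
  have h2 : ContinuousAt (fun x : ℝ ↦ (x : ℂ) + y * I) x := by fun_prop
  exact ((ContinuousAt.comp (f := fun x : ℝ ↦ (x : ℂ) + y * I) h1 h2).pow 24).inv₀
    (pow_ne_zero _ (ModularForm.eta_ne_zero (him x)))

lemma continuous_polarKernel_horizontal (n : ℝ) {y : ℝ} (hy : 0 < y) :
    Continuous fun x : ℝ ↦ polarKernel n (x + y * I) := by
  have h0 : ∀ x : ℝ, (x : ℂ) + y * I ≠ 0 := fun x ↦ add_mul_I_ne_zero (Or.inr hy.ne')
  unfold polarKernel
  fun_prop (disch := exact h0 _)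

lemma abs_multiCount_sub_mainTerm_lt {n : ℕ} (hn : 64 ≤ n) :
    |(multiCount (n + 1) : ℝ) - mainTerm n| < mainTerm n / 12 := by
  set s : ℝ := √n with hsdef
  have hs2 : s ^ 2 = n := Real.sq_sqrt (by positivity)
  have hs : 8 ≤ s := Real.le_sqrt_of_sq_le (by norm_num; exact_mod_cast hn)
  have hy : 0 < s⁻¹ := by positivity
  have hcount := integral_invDisc n hy
  have hcast : (n : ℂ) = ((s ^ 2 : ℝ) : ℂ) := by rw [hs2]; simp
  simp only [hcast] at hcount
  have hdiff : ‖(multiCount (n + 1) : ℂ) -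
      ∫ x in (-(1 / 2) : ℝ)..1 / 2, polarKernel (s ^ 2) (x + (s⁻¹ : ℝ) * I)‖ ≤
      2 * exp (5 / 2 * π * s + 2 * π / s) := by
    rw [← hcount, ← intervalIntegral.integral_sub]
    · refine (intervalIntegral.norm_integral_le_of_norm_le_const fun x hx ↦
        norm_invDisc_sub_polarKernel_le hs ?_).trans (by norm_num)
      rw [Set.uIoc_of_le (by norm_num)] at hx
      exact abs_le.2 ⟨hx.1.le, hx.2⟩
    · exact ((continuous_invDisc_horizontal hy).mul (by fun_prop)).intervalIntegrable _ _
    · exact (continuous_polarKernel_horizontal _ hy).intervalIntegrable _ _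
  have hmain := norm_integral_polarKernel_sub_le hs
  have htri := norm_sub_le_norm_sub_add_norm_sub (multiCount (n + 1) : ℂ)
    (∫ x in (-(1 / 2) : ℝ)..1 / 2, polarKernel (s ^ 2) (x + (s⁻¹ : ℝ) * I))
    (mainTerm (s ^ 2) : ℂ)
  have hnorm : ‖(multiCount (n + 1) : ℂ) - (mainTerm (s ^ 2) : ℂ)‖ =
      |(multiCount (n + 1) : ℝ) - mainTerm (s ^ 2)| := by
    rw [← Complex.ofReal_natCast, ← Complex.ofReal_sub, Complex.norm_real, Real.norm_eq_abs]
  have herr := error_lt_mainTerm hs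
  rw [← hs2, ← hnorm]
  linarith

lemma multiCount_bounds {n : ℕ} (hn : 1 ≤ n) :
    (1 - 1 / 12) * mainTerm n < multiCount (n + 1) ∧
      (multiCount (n + 1) : ℝ) < (1 + 1 / 12) * mainTerm n := by
  rcases lt_or_ge n 64 with h | h
  · exact bounds_of_lt hn h
  · have := abs_lt.1 (abs_multiCount_sub_mainTerm_lt h)
    constructor <;> linarith

end PartitionSeries

theorem stmt1 (n : ℕ) (hn : 1 ≤ n) :
    (1 - 1 / 12) * (2 * Real.pi) * (n : ℝ) ^ (-(13 : ℝ) / 2) *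
        besselI 13 (4 * Real.pi * Real.sqrt n) < (dcoef n : ℝ) ∧
    (dcoef n : ℝ) < (1 + 1 / 12) * (2 * Real.pi) * (n : ℝ) ^ (-(13 : ℝ) / 2) *
        besselI 13 (4 * Real.pi * Real.sqrt n) := by
  have h := PartitionSeries.multiCount_bounds hn
  rw [← PartitionSeries.bessel_eq_mainTerm (by exact_mod_cast hn)] at h
  rw [PartitionSeries.dcoef_natCast]
  push_cast
  constructor <;> linarith
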